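/- arXiv:1509.07679 — 8 statements merged into one kernel-verified Lean document; each statement's English description precedes it below -/
import Mathlib

section
/- Forward graph transform (refined version, graph and Lipschitz estimate): Assume R₀ ≤ R₁ and that g maps B_k(0,R₀) holomorphically into B_k(0,R₁), that ‖B‖ < ‖A⁻¹‖⁻¹, and let 0 ≤ γ₀ ≤ 1. Let φ : D → ℂ^{k₂} with D ⊆ ℂ^{k₁} be such that its horizontal graph is contained in B_k(0,R₀) and Lip(φ) ≤ γ₀. If δ‖A⁻¹‖(1+γ₀) < 1, then the image g(graph φ) is the horizontal graph of a function ψ defined on π₀(g(graph φ)), and for all X₁, X₂ in this set one has ‖ψ(X₁) − ψ(X₂)‖ ≤ [(‖B‖γ₀ + δ(1+γ₀)) / (‖A⁻¹‖⁻¹ − δ(1+γ₀))] · ‖X₁ − X₂‖. -/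
open Metric Set

noncomputable section

/-- ℂ^k with the Euclidean norm. -/
abbrev Eu (k : ℕ) : Type := EuclideanSpace ℂ (Fin k)

/-- ℂ^{k₁} × ℂ^{k₂} with the Euclidean (L²) product norm. -/
abbrev Prod2 (k₁ k₂ : ℕ) : Type := WithLp 2 (Eu k₁ × Eu k₂)

/-- The point (X,Y) of ℂ^{k₁} × ℂ^{k₂}. -/
def mk2 {k₁ k₂ : ℕ} (X : Eu k₁) (Y : Eu k₂) : Prod2 k₁ k₂ :=
  (WithLp.equiv 2 (Eu k₁ × Eu k₂)).symm (X, Y)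

/-- Horizontal coordinate projection π₀. -/
def fst2 {k₁ k₂ : ℕ} (Z : Prod2 k₁ k₂) : Eu k₁ := (WithLp.equiv 2 (Eu k₁ × Eu k₂) Z).1

/-- Vertical coordinate projection π₂. -/
def snd2 {k₁ k₂ : ℕ} (Z : Prod2 k₁ k₂) : Eu k₂ := (WithLp.equiv 2 (Eu k₁ × Eu k₂) Z).2

/-- Horizontal graph {(X, φ(X)) : X ∈ D}. -/
def hgraph {k₁ k₂ : ℕ} (φ : Eu k₁ → Eu k₂) (D : Set (Eu k₁)) : Set (Prod2 k₁ k₂) :=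
  (fun X => mk2 X (φ X)) '' D

/-- Vertical graph {(φ(Y), Y) : Y ∈ D}. -/
def vgraph {k₁ k₂ : ℕ} (φ : Eu k₂ → Eu k₁) (D : Set (Eu k₂)) : Set (Prod2 k₁ k₂) :=
  (fun Y => mk2 (φ Y) Y) '' D

lemma norm_mk2_sub_le {k₁ k₂ : ℕ} (X X' : Eu k₁) (Y Y' : Eu k₂) :
    ‖mk2 X Y - mk2 X' Y'‖ ≤ ‖X - X'‖ + ‖Y - Y'‖ := by
  have h : mk2 X Y - mk2 X' Y' = mk2 (X - X') 0 + mk2 0 (Y - Y') := by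
    simp [mk2, ← WithLp.toLp_sub, ← WithLp.toLp_add]
  rw [h]
  exact (norm_add_le _ _).trans_eq (congrArg₂ (· + ·)
    (WithLp.norm_toLp_fst 2 _ _ _) (WithLp.norm_toLp_snd 2 _ _ _))

/-- A set on which the vertical coordinate is controlled by the horizontal one is the horizontal
graph of a Lipschitz function over its horizontal projection. -/
lemma exists_eq_hgraph_of_norm_snd2_sub_le {k₁ k₂ : ℕ} {S : Set (Prod2 k₁ k₂)} {C : ℝ}
    (h : ∀ p ∈ S, ∀ q ∈ S, ‖snd2 p - snd2 q‖ ≤ C * ‖fst2 p - fst2 q‖) :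
    ∃ ψ : Eu k₁ → Eu k₂, S = hgraph ψ (fst2 '' S) ∧
      ∀ X₁ ∈ fst2 '' S, ∀ X₂ ∈ fst2 '' S, ‖ψ X₁ - ψ X₂‖ ≤ C * ‖X₁ - X₂‖ := by
  classical
  let ψ : Eu k₁ → Eu k₂ := fun X => if hX : X ∈ fst2 '' S then snd2 hX.choose else 0
  have hψ : ∀ p ∈ S, ψ (fst2 p) = snd2 p := by
    intro p hp
    have hX : fst2 p ∈ fst2 '' S := mem_image_of_mem _ hp
    have hle := h _ hX.choose_spec.1 p hp
    rw [hX.choose_spec.2, sub_self, norm_zero, mul_zero] at hle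
    simpa only [ψ, dif_pos hX] using sub_eq_zero.mp (norm_le_zero_iff.mp hle)
  refine ⟨ψ, ?_, ?_⟩
  · have hmk : ∀ p ∈ S, mk2 (fst2 p) (ψ (fst2 p)) = p := fun p hp => by rw [hψ p hp]; rfl
    rw [hgraph, image_image, image_congr hmk, image_id']
  · rintro _ ⟨p, hp, rfl⟩ _ ⟨q, hq, rfl⟩
    rw [hψ p hp, hψ q hq]
    exact h p hp q hq

lemma inv_norm_symm_mul_norm_le {𝕜 E F : Type*} [NontriviallyNormedField 𝕜]
    [NormedAddCommGroup E] [NormedSpace 𝕜 E] [NormedAddCommGroup F] [NormedSpace 𝕜 F]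
    (A : E ≃L[𝕜] F) (x : E) : ‖(A.symm : F →L[𝕜] E)‖⁻¹ * ‖x‖ ≤ ‖A x‖ := by
  have h : ‖x‖ ≤ ‖(A.symm : F →L[𝕜] E)‖ * ‖A x‖ := by
    simpa using (A.symm : F →L[𝕜] E).le_opNorm (A x)
  exact inv_mul_le_of_le_mul₀ (norm_nonneg _) (norm_nonneg _) h

/-- Forward graph transform (refined version, graph and Lipschitz
estimate). -/
theorem forward_graph_transform_lipschitz
    (k₁ k₂ : ℕ) (hk₁ : 0 < k₁) (hk₂ : 0 < k₂)
    (A : Eu k₁ ≃L[ℂ] Eu k₁) (B : Eu k₂ →L[ℂ] Eu k₂)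
    (R : Prod2 k₁ k₂ → Eu k₁) (U : Prod2 k₁ k₂ → Eu k₂)
    (g : Prod2 k₁ k₂ → Prod2 k₁ k₂) (R₀ R₁ δ : ℝ)
    (hR₀ : 0 < R₀) (hδ : 0 ≤ δ) (hR₀R₁ : R₀ ≤ R₁)
    (hg : ∀ Z, g Z = mk2 (A (fst2 Z) + R Z) (B (snd2 Z) + U Z))
    (hg0 : g 0 = 0)
    (hgmaps : MapsTo g (ball (0 : Prod2 k₁ k₂) R₀) (ball (0 : Prod2 k₁ k₂) R₁))
    (hRdiff : ∀ Z ∈ ball (0 : Prod2 k₁ k₂) R₀, DifferentiableAt ℂ R Z ∧ ‖fderiv ℂ R Z‖ ≤ δ)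
    (hUdiff : ∀ Z ∈ ball (0 : Prod2 k₁ k₂) R₀, DifferentiableAt ℂ U Z ∧ ‖fderiv ℂ U Z‖ ≤ δ)
    (hB : ‖B‖ < ‖(A.symm : Eu k₁ →L[ℂ] Eu k₁)‖⁻¹)
    (γ₀ : ℝ) (hγ₀ : 0 ≤ γ₀) (hγ₀1 : γ₀ ≤ 1)
    (φ : Eu k₁ → Eu k₂) (D : Set (Eu k₁))
    (hgraphD : hgraph φ D ⊆ ball (0 : Prod2 k₁ k₂) R₀)
    (hφlip : ∀ X₁ ∈ D, ∀ X₂ ∈ D, ‖φ X₁ - φ X₂‖ ≤ γ₀ * ‖X₁ - X₂‖)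
    (hδA : δ * ‖(A.symm : Eu k₁ →L[ℂ] Eu k₁)‖ * (1 + γ₀) < 1) :
    ∃ ψ : Eu k₁ → Eu k₂,
      g '' hgraph φ D = hgraph ψ (fst2 '' (g '' hgraph φ D)) ∧
      ∀ X₁ ∈ fst2 '' (g '' hgraph φ D), ∀ X₂ ∈ fst2 '' (g '' hgraph φ D),
        ‖ψ X₁ - ψ X₂‖ ≤
          (‖B‖ * γ₀ + δ * (1 + γ₀)) /
            (‖(A.symm : Eu k₁ →L[ℂ] Eu k₁)‖⁻¹ - δ * (1 + γ₀)) * ‖X₁ - X₂‖ := by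
  have ha : 0 < ‖(A.symm : Eu k₁ →L[ℂ] Eu k₁)‖ := inv_pos.mp ((norm_nonneg B).trans_lt hB)
  have hc : 0 < ‖(A.symm : Eu k₁ →L[ℂ] Eu k₁)‖⁻¹ - δ * (1 + γ₀) := by
    rw [sub_pos, inv_eq_one_div, lt_div_iff₀ ha]
    linarith
  apply exists_eq_hgraph_of_norm_snd2_sub_le
  rintro _ ⟨_, ⟨X, hX, rfl⟩, rfl⟩ _ ⟨_, ⟨X', hX', rfl⟩, rfl⟩
  have hZ := hgraphD (mem_image_of_mem _ hX)
  have hZ' := hgraphD (mem_image_of_mem _ hX')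
  simp only [hg]
  set Z := mk2 X (φ X)
  set Z' := mk2 X' (φ X')
  have hφ := hφlip X hX X' hX'
  have hdist : δ * ‖Z - Z'‖ ≤ δ * (1 + γ₀) * ‖X - X'‖ := by
    rw [mul_assoc]
    refine mul_le_mul_of_nonneg_left ?_ hδ
    linarith [norm_mk2_sub_le X X' (φ X) (φ X')]
  have hR : ‖R Z - R Z'‖ ≤ δ * (1 + γ₀) * ‖X - X'‖ :=
    ((convex_ball _ _).norm_image_sub_le_of_norm_fderiv_le (fun W hW => (hRdiff W hW).1)
      (fun W hW => (hRdiff W hW).2) hZ' hZ).trans hdist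
  have hU : ‖U Z - U Z'‖ ≤ δ * (1 + γ₀) * ‖X - X'‖ :=
    ((convex_ball _ _).norm_image_sub_le_of_norm_fderiv_le (fun W hW => (hUdiff W hW).1)
      (fun W hW => (hUdiff W hW).2) hZ' hZ).trans hdist
  change ‖(B (φ X) + U Z) - (B (φ X') + U Z')‖ ≤ _ * ‖(A X + R Z) - (A X' + R Z')‖
  have hBφ : ‖B (φ X - φ X')‖ ≤ ‖B‖ * γ₀ * ‖X - X'‖ := by
    rw [mul_assoc]
    exact B.le_opNorm_of_le hφ
  have hA := inv_norm_symm_mul_norm_le A (X - X')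
  rw [add_sub_add_comm, add_sub_add_comm, ← map_sub, ← map_sub]
  have hvert := norm_add_le (B (φ X - φ X')) (U Z - U Z')
  have hhor := norm_sub_le_norm_add (A (X - X')) (R Z - R Z')
  have hlow : ‖X - X'‖ ≤ ‖A (X - X') + (R Z - R Z')‖ /
      (‖(A.symm : Eu k₁ →L[ℂ] Eu k₁)‖⁻¹ - δ * (1 + γ₀)) := by
    rw [le_div_iff₀ hc]
    linarith
  calc ‖B (φ X - φ X') + (U Z - U Z')‖
      ≤ (‖B‖ * γ₀ + δ * (1 + γ₀)) * ‖X - X'‖ := by linarith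
    _ ≤ (‖B‖ * γ₀ + δ * (1 + γ₀)) * (‖A (X - X') + (R Z - R Z')‖ /
        (‖(A.symm : Eu k₁ →L[ℂ] Eu k₁)‖⁻¹ - δ * (1 + γ₀))) :=
      mul_le_mul_of_nonneg_left hlow (by positivity)
    _ = _ := by rw [mul_div_assoc', div_mul_eq_mul_div]
end
end

section
/- Key estimates in the backward graph transform: under all the hypotheses of the backward graph transform theorem (γ > 0 with e^{2γ} < 3/2, 0 ≤ γ₀ ≤ 1, ξ = 1 − ‖B‖‖A⁻¹‖ ∈ (0,1], φ : B_{k₂}(0,α) → ℂ^{k₁} with vertical graph in B_k(0,R₀), ‖φ(0)‖ ≤ β, Lip(φ) ≤ γ₀, β ≤ α ≤ R₀/4, γ₀(1−ξ) + 2δ(1+γ₀)‖A⁻¹‖ ≤ 1, (γ₀‖B‖ + δ(1+γ₀))(‖A⁻¹‖⁻¹ − δ(1+γ₀))⁻¹ ≤ e^{−γ}γ₀, (‖B‖ + 2δ)e^{2γ} + δ ≤ 1, and δ(1+γ₀) ≤ min{(‖A⁻¹‖⁻¹ − γ₀‖B‖)/2, ‖A⁻¹‖⁻¹ − e^{2γ}}),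 write g = (g₁, g₂) in coordinates and set L = {(X,Y) : ‖X‖ ≤ ‖Y‖ + βe^{−2γ}, ‖Y‖ < αe^{2γ}}. Then: (i) L ⊆ B_k(0,R₀); (ii) ‖g₂(X,Y)‖ < α for every (X,Y) ∈ L; and (iii) for every fixed Y ∈ B_{k₂}(0, αe^{2γ}), the map Λ_Y(X) = A⁻¹[φ(g₂(X,Y)) − (g₁(X,Y) − AX)] maps the closed ball B̄_{k₁}(0, ‖Y‖ + βe^{−2γ}) into itself. -/
open Metric Set

noncomputable section

section Coordinates

variable {k₁ k₂ : ℕ}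

@[simp] theorem fst2_mk2 (X : Eu k₁) (Y : Eu k₂) : fst2 (mk2 X Y) = X := rfl

@[simp] theorem snd2_mk2 (X : Eu k₁) (Y : Eu k₂) : snd2 (mk2 X Y) = Y := rfl

@[simp] theorem fst2_zero : fst2 (0 : Prod2 k₁ k₂) = 0 := rfl

@[simp] theorem snd2_zero : snd2 (0 : Prod2 k₁ k₂) = 0 := rfl

theorem norm_le_norm_fst2_add_norm_snd2 (Z : Prod2 k₁ k₂) : ‖Z‖ ≤ ‖fst2 Z‖ + ‖snd2 Z‖ := by
  have h : ‖Z‖ ^ 2 = ‖fst2 Z‖ ^ 2 + ‖snd2 Z‖ ^ 2 := WithLp.prod_norm_sq_eq_of_L2 Z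
  nlinarith [norm_nonneg Z, norm_nonneg (fst2 Z), norm_nonneg (snd2 Z)]

end Coordinates

/-- A map vanishing at the centre of a ball, with derivative bounded by `C` there, grows at most
linearly with slope `C`. -/
theorem norm_le_mul_norm_of_norm_fderiv_le {E F : Type*} [NormedAddCommGroup E]
    [NormedSpace ℂ E] [NormedAddCommGroup F] [NormedSpace ℂ F] {f : E → F} {r C : ℝ}
    (hf : ∀ z ∈ ball (0 : E) r, DifferentiableAt ℂ f z ∧ ‖fderiv ℂ f z‖ ≤ C) (hf0 : f 0 = 0)
    {z : E} (hz : z ∈ ball (0 : E) r) : ‖f z‖ ≤ C * ‖z‖ := by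
  let _ : NormedSpace ℝ E := NormedSpace.restrictScalars ℝ ℂ E
  have h0 : (0 : E) ∈ ball (0 : E) r := mem_ball_self (pos_of_mem_ball hz)
  simpa [hf0] using (convex_ball (0 : E) r).norm_image_sub_le_of_norm_fderiv_le (𝕜 := ℂ)
    (fun x hx => (hf x hx).1) (fun x hx => (hf x hx).2) h0 hz

/-- Key estimates in the backward graph transform. -/
theorem backward_graph_transform_key_estimates
    (k₁ k₂ : ℕ) (hk₁ : 0 < k₁) (hk₂ : 0 < k₂)
    (A : Eu k₁ ≃L[ℂ] Eu k₁) (B : Eu k₂ →L[ℂ] Eu k₂)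
    (R : Prod2 k₁ k₂ → Eu k₁) (U : Prod2 k₁ k₂ → Eu k₂)
    (g : Prod2 k₁ k₂ → Prod2 k₁ k₂) (R₀ δ : ℝ)
    (hR₀ : 0 < R₀) (hδ : 0 ≤ δ)
    (hg : ∀ Z, g Z = mk2 (A (fst2 Z) + R Z) (B (snd2 Z) + U Z))
    (hg0 : g 0 = 0)
    (hRdiff : ∀ Z ∈ ball (0 : Prod2 k₁ k₂) R₀, DifferentiableAt ℂ R Z ∧ ‖fderiv ℂ R Z‖ ≤ δ)
    (hUdiff : ∀ Z ∈ ball (0 : Prod2 k₁ k₂) R₀, DifferentiableAt ℂ U Z ∧ ‖fderiv ℂ U Z‖ ≤ δ)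
    (γ γ₀ : ℝ) (hγ : 0 < γ) (hγ32 : Real.exp (2 * γ) < 3 / 2)
    (hγ₀ : 0 ≤ γ₀) (hγ₀1 : γ₀ ≤ 1)
    (hBA : ‖B‖ * ‖(A.symm : Eu k₁ →L[ℂ] Eu k₁)‖ < 1)
    (φ : Eu k₂ → Eu k₁) (α β : ℝ) (hβα : β ≤ α) (hαR₀ : α ≤ R₀ / 4)
    (hgraphφ : vgraph φ (ball (0 : Eu k₂) α) ⊆ ball (0 : Prod2 k₁ k₂) R₀)
    (hφ0 : ‖φ 0‖ ≤ β)
    (hφlip : ∀ Y₁ ∈ ball (0 : Eu k₂) α, ∀ Y₂ ∈ ball (0 : Eu k₂) α,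
      ‖φ Y₁ - φ Y₂‖ ≤ γ₀ * ‖Y₁ - Y₂‖)
    (hineq1 : γ₀ * (‖B‖ * ‖(A.symm : Eu k₁ →L[ℂ] Eu k₁)‖) +
        2 * δ * (1 + γ₀) * ‖(A.symm : Eu k₁ →L[ℂ] Eu k₁)‖ ≤ 1)
    (hineq2 : (γ₀ * ‖B‖ + δ * (1 + γ₀)) *
        (‖(A.symm : Eu k₁ →L[ℂ] Eu k₁)‖⁻¹ - δ * (1 + γ₀))⁻¹ ≤ Real.exp (-γ) * γ₀)
    (hineq3 : (‖B‖ + 2 * δ) * Real.exp (2 * γ) + δ ≤ 1)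
    (hineq4 : δ * (1 + γ₀) ≤
      min ((‖(A.symm : Eu k₁ →L[ℂ] Eu k₁)‖⁻¹ - γ₀ * ‖B‖) / 2)
        (‖(A.symm : Eu k₁ →L[ℂ] Eu k₁)‖⁻¹ - Real.exp (2 * γ)))
    (L : Set (Prod2 k₁ k₂))
    (hL : L = {Z : Prod2 k₁ k₂ | ‖fst2 Z‖ ≤ ‖snd2 Z‖ + β * Real.exp (-(2 * γ)) ∧
      ‖snd2 Z‖ < α * Real.exp (2 * γ)}) :
    L ⊆ ball (0 : Prod2 k₁ k₂) R₀ ∧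
    (∀ Z ∈ L, ‖snd2 (g Z)‖ < α) ∧
    (∀ Y : Eu k₂, ‖Y‖ < α * Real.exp (2 * γ) →
      ∀ X ∈ closedBall (0 : Eu k₁) (‖Y‖ + β * Real.exp (-(2 * γ))),
        ‖A.symm (φ (snd2 (g (mk2 X Y))) - (fst2 (g (mk2 X Y)) - A X))‖ ≤
          ‖Y‖ + β * Real.exp (-(2 * γ))) := by
  obtain ⟨hR0, hU0⟩ : R 0 = 0 ∧ U 0 = 0 := by
    have h := (hg 0).symm.trans hg0
    exact ⟨by simpa using congrArg fst2 h, by simpa using congrArg snd2 h⟩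
  have hexp := (le_min_iff.1 hineq4).2
  have hβ : 0 ≤ β := (norm_nonneg _).trans hφ0
  set e := Real.exp (2 * γ) with he
  set b := β * Real.exp (-(2 * γ)) with hb
  set a := ‖(A.symm : Eu k₁ →L[ℂ] Eu k₁)‖ with ha
  have he1 : 1 < e := Real.one_lt_exp_iff.2 (by linarith)
  have heb : e * b = β := by
    rw [hb, he, mul_left_comm, ← Real.exp_add]
    simp
  have hb0 : 0 ≤ b := by positivity
  have hbβ : b ≤ β := heb ▸ le_mul_of_one_le_left hb0 he1.le
  have hα_of_lt : 0 < α * e → 0 < α := (mul_pos_iff_of_pos_right (by linarith)).1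
  have ha0 : 0 < a := by
    by_contra hneg
    have h := inv_nonpos.2 (not_lt.1 hneg)
    linarith [mul_nonneg hδ (by linarith : (0 : ℝ) ≤ 1 + γ₀)]
  have hball : L ⊆ ball (0 : Prod2 k₁ k₂) R₀ := by
    intro Z hZ
    rw [hL] at hZ
    obtain ⟨hZ₁, hZ₂⟩ := hZ
    have hn := norm_le_norm_fst2_add_norm_snd2 Z
    rw [mem_ball_zero_iff]
    linarith [mul_lt_mul_of_pos_left hγ32 (hα_of_lt ((norm_nonneg _).trans_lt hZ₂))]
  have hlin : ∀ Z ∈ L, ‖Z‖ ≤ 2 * ‖snd2 Z‖ + b := by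
    intro Z hZ
    rw [hL] at hZ
    linarith [norm_le_norm_fst2_add_norm_snd2 Z, hZ.1]
  have hRb : ∀ Z ∈ L, ‖R Z‖ ≤ δ * (2 * ‖snd2 Z‖ + b) := fun Z hZ =>
    (norm_le_mul_norm_of_norm_fderiv_le hRdiff hR0 (hball hZ)).trans
      (mul_le_mul_of_nonneg_left (hlin Z hZ) hδ)
  have hg₂ : ∀ Z ∈ L, ‖snd2 (g Z)‖ ≤ ‖B‖ * ‖snd2 Z‖ + δ * (2 * ‖snd2 Z‖ + b) := by
    intro Z hZ
    rw [hg, snd2_mk2]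
    exact (norm_add_le _ _).trans (add_le_add (B.le_opNorm _)
      ((norm_le_mul_norm_of_norm_fderiv_le hUdiff hU0 (hball hZ)).trans
        (mul_le_mul_of_nonneg_left (hlin Z hZ) hδ)))
  have hg₂α : ∀ Z ∈ L, ‖snd2 (g Z)‖ < α := by
    intro Z hZ
    refine (hg₂ Z hZ).trans_lt ?_
    rw [hL] at hZ
    have hY : ‖snd2 Z‖ < α * e := hZ.2
    have hα : 0 < α := hα_of_lt ((norm_nonneg _).trans_lt hY)
    have hδb : δ * b ≤ δ * α := mul_le_mul_of_nonneg_left (hbβ.trans hβα) hδ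
    have hα3 := mul_le_mul_of_nonneg_left hineq3 hα.le
    rcases (by positivity : 0 ≤ ‖B‖ + 2 * δ).eq_or_lt with hc | hc
    · have hδ0 : δ = 0 := by linarith [norm_nonneg B]
      have hB0 : ‖B‖ = 0 := by linarith
      simpa [hδ0, hB0] using hα
    · linarith [mul_lt_mul_of_pos_left hY hc]
  refine ⟨hball, hg₂α, fun Y hY X hX => ?_⟩
  have hXY : mk2 X Y ∈ L := by
    rw [hL]
    exact ⟨mem_closedBall_zero_iff.1 hX, hY⟩
  have hα : 0 < α := hα_of_lt ((norm_nonneg _).trans_lt hY)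
  have hφ : ‖φ (snd2 (g (mk2 X Y)))‖ ≤ β + γ₀ * ‖snd2 (g (mk2 X Y))‖ := by
    have h := hφlip _ (mem_ball_zero_iff.2 (hg₂α _ hXY)) 0 (mem_ball_self hα)
    rw [sub_zero] at h
    linarith [norm_le_norm_add_norm_sub' (φ (snd2 (g (mk2 X Y)))) (φ 0)]
  have hfst : fst2 (g (mk2 X Y)) - A X = R (mk2 X Y) := by simp [hg]
  have hRXY : ‖R (mk2 X Y)‖ ≤ δ * (2 * ‖Y‖ + b) := hRb _ hXY
  have hg₂XY : ‖snd2 (g (mk2 X Y))‖ ≤ ‖B‖ * ‖Y‖ + δ * (2 * ‖Y‖ + b) := hg₂ _ hXY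
  have hconst : a * (e + δ * (1 + γ₀)) ≤ 1 := by
    have h := mul_le_mul_of_nonneg_left (by linarith : e + δ * (1 + γ₀) ≤ a⁻¹) ha0.le
    rwa [mul_inv_cancel₀ ha0.ne'] at h
  have hA : ∀ W : Eu k₁, ‖A.symm W‖ ≤ a * ‖W‖ :=
    fun W => ContinuousLinearMap.le_opNorm (A.symm : Eu k₁ →L[ℂ] Eu k₁) W
  rw [hfst]
  calc ‖A.symm (φ (snd2 (g (mk2 X Y))) - R (mk2 X Y))‖
      ≤ a * ‖φ (snd2 (g (mk2 X Y))) - R (mk2 X Y)‖ :=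
        hA _
    _ ≤ a * (e * b + γ₀ * (‖B‖ * ‖Y‖ + δ * (2 * ‖Y‖ + b)) + δ * (2 * ‖Y‖ + b)) := by
        refine mul_le_mul_of_nonneg_left ((norm_sub_le _ _).trans ?_) ha0.le
        rw [heb]
        linarith [mul_le_mul_of_nonneg_left hg₂XY hγ₀]
    _ = (γ₀ * (‖B‖ * a) + 2 * δ * (1 + γ₀) * a) * ‖Y‖ + a * (e + δ * (1 + γ₀)) * b := by ring
    _ ≤ 1 * ‖Y‖ + 1 * b := by gcongr
    _ = ‖Y‖ + b := by ring
end
end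

section
/- Forward push of horizontal graphs in Pesin-type coordinates (abstract form of Lemma 1): Let γ > 0 and 0 < γ₀ ≤ 1 with γ₀ < e^{γ/4} − 1. There exists h₀ > 0, depending only on γ and γ₀, with the following property. Let h ∈ (0, h₀], let r, r′ ∈ (0,1] with e^{−γ} ≤ r′/r ≤ e^{γ}, and suppose g is as in the setting with R₀ = 5hr and δ = 5h (i.e. g is holomorphic on B_k(0, 5hr), g(0)=0, and max(‖DR‖,‖DU‖) ≤ 5h on B_k(0,5hr)), and that ‖A⁻¹‖⁻¹ ≥ e^{4γ} and ‖B‖ ≤ e^{−4γ}. Then for every φ : B_{k₁}(0, hr) → ℂ^{k₂} with Lip(φ) ≤ γ₀ and ‖φ(0)‖ ≤ hr, the image g(horizontal graph of φ) is the horizontal graph of a function ψ defined over a subset of ℂ^{k₁} containing B_{k₁}(0, h r′ e^{γ}), with ‖ψ(0)‖ ≤ e^{−2γ}‖φ(0)‖ and Lip(ψ) ≤ γ₀ e^{−γ}. -/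
open Metric Set

noncomputable section

theorem norm_mk2_le {k₁ k₂ : ℕ} (X : Eu k₁) (Y : Eu k₂) : ‖mk2 X Y‖ ≤ ‖X‖ + ‖Y‖ := by
  have hsq : ‖mk2 X Y‖ ^ 2 = ‖X‖ ^ 2 + ‖Y‖ ^ 2 := WithLp.prod_norm_sq_eq_of_L2 (mk2 X Y)
  refine le_of_sq_le_sq ?_ (by positivity)
  nlinarith [mul_nonneg (norm_nonneg X) (norm_nonneg Y)]

theorem mk2_sub {k₁ k₂ : ℕ} (X₁ X₂ : Eu k₁) (Y₁ Y₂ : Eu k₂) :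
    mk2 X₁ Y₁ - mk2 X₂ Y₂ = mk2 (X₁ - X₂) (Y₁ - Y₂) := rfl

/-- If `F` expands distances on `s` by at least `m` and `G` is `L`-Lipschitz on `s` with
`L ≤ K * m`, then the curve `x ↦ (F x, G x)` over `s` is the graph of a `K`-Lipschitz function
over `F '' s`. -/
theorem exists_graph_of_expanding {E E' E'' : Type*} [NormedAddCommGroup E]
    [NormedAddCommGroup E'] [NormedAddCommGroup E''] {F : E → E'} {G : E → E''} {s : Set E}
    {m L K : ℝ} (hm : 0 < m) (hK : 0 ≤ K) (hLK : L ≤ K * m)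
    (hF : ∀ x ∈ s, ∀ y ∈ s, m * ‖x - y‖ ≤ ‖F x - F y‖)
    (hG : ∀ x ∈ s, ∀ y ∈ s, ‖G x - G y‖ ≤ L * ‖x - y‖) :
    ∃ ψ : E' → E'', (∀ x ∈ s, ψ (F x) = G x) ∧
      ∀ u ∈ F '' s, ∀ v ∈ F '' s, ‖ψ u - ψ v‖ ≤ K * ‖u - v‖ := by
  have hinj : InjOn F s := by
    intro x hx y hy hxy
    have hxy' := hF x hx y hy
    rw [hxy, sub_self, norm_zero] at hxy'
    exact sub_eq_zero.1 (norm_le_zero_iff.1 (nonpos_of_mul_nonpos_right hxy' hm))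
  rcases s.eq_empty_or_nonempty with rfl | ⟨x₀, hx₀⟩
  · exact ⟨fun _ => 0, by simp, by simp⟩
  have : Nonempty E := ⟨x₀⟩
  have hψ : ∀ x ∈ s, G (Function.invFunOn F s (F x)) = G x := fun x hx => by
    rw [hinj.leftInvOn_invFunOn hx]
  refine ⟨fun u => G (Function.invFunOn F s u), hψ, ?_⟩
  rintro _ ⟨x, hx, rfl⟩ _ ⟨y, hy, rfl⟩
  simp only [hψ x hx, hψ y hy]
  calc ‖G x - G y‖ ≤ L * ‖x - y‖ := hG x hx y hy
    _ ≤ K * m * ‖x - y‖ := by gcongr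
    _ = K * (m * ‖x - y‖) := by ring
    _ ≤ K * ‖F x - F y‖ := by gcongr; exact hF x hx y hy

/-- A perturbation of an invertible linear map maps a ball onto a definite ball around `0`. -/
theorem ball_subset_image_of_approximatesLinearOn {E : Type*} [NormedAddCommGroup E]
    [NormedSpace ℂ E] [CompleteSpace E] {F : E → E} {A : E ≃L[ℂ] E} {c : NNReal} {M ρ t : ℝ}
    (hF : ApproximatesLinearOn F (A : E →L[ℂ] E) (ball 0 ρ) c)
    (hA : M ≤ ‖(A.symm : E →L[ℂ] E)‖⁻¹) (hcM : c < M)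
    (ht : t + ‖F 0‖ ≤ (M - c) * ρ) :
    ball (0 : E) t ⊆ F '' ball 0 ρ := by
  intro W hW
  rw [mem_ball_zero_iff] at hW
  have hpos : 0 < M - c := sub_pos.2 hcM
  set ε : ℝ := (‖W‖ + ‖F 0‖) / (M - c) with hε
  have hε0 : 0 ≤ ε := by positivity
  have hερ : ε < ρ := by
    rw [hε, div_lt_iff₀ hpos]
    linarith
  have hsurj := hF.surjOn_closedBall_of_nonlinearRightInverse A.toNonlinearRightInverse hε0
    (closedBall_subset_ball hερ)
  have hmem : W ∈ closedBall (F 0)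
      (((A.toNonlinearRightInverse.nnnorm : ℝ)⁻¹ - c) * ε) := by
    rw [mem_closedBall_iff_norm]
    calc ‖W - F 0‖ ≤ ‖W‖ + ‖F 0‖ := norm_sub_le _ _
      _ = (M - c) * ε := by rw [hε]; field_simp
      _ ≤ _ := by gcongr; exact hA
  obtain ⟨x, hx, rfl⟩ := hsurj hmem
  exact ⟨x, closedBall_subset_ball hερ hx, rfl⟩

theorem mul_norm_le_norm_apply {E : Type*} [NormedAddCommGroup E] [NormedSpace ℂ E]
    {A : E ≃L[ℂ] E} {M : ℝ} (hM : 0 < M) (hA : M ≤ ‖(A.symm : E →L[ℂ] E)‖⁻¹) (x : E) :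
    M * ‖x‖ ≤ ‖A x‖ := by
  have hpos : 0 < ‖(A.symm : E →L[ℂ] E)‖ := inv_pos.1 (hM.trans_le hA)
  have hx : ‖x‖ ≤ ‖(A.symm : E →L[ℂ] E)‖ * ‖A x‖ := by
    simpa using (A.symm : E →L[ℂ] E).le_opNorm (A x)
  calc M * ‖x‖ ≤ ‖(A.symm : E →L[ℂ] E)‖⁻¹ * (‖(A.symm : E →L[ℂ] E)‖ * ‖A x‖) := by gcongr
    _ = ‖A x‖ := by field_simp

theorem norm_apply_mk2_sub_le {k₁ k₂ : ℕ} {E : Type*} [NormedAddCommGroup E] [NormedSpace ℂ E]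
    {S : Prod2 k₁ k₂ → E} {ρ δ : ℝ}
    (hS : ∀ Z ∈ ball (0 : Prod2 k₁ k₂) ρ, DifferentiableAt ℂ S Z ∧ ‖fderiv ℂ S Z‖ ≤ δ)
    {X₁ X₂ : Eu k₁} {Y₁ Y₂ : Eu k₂} (h₁ : ‖X₁‖ + ‖Y₁‖ < ρ) (h₂ : ‖X₂‖ + ‖Y₂‖ < ρ) :
    ‖S (mk2 X₁ Y₁) - S (mk2 X₂ Y₂)‖ ≤ δ * (‖X₁ - X₂‖ + ‖Y₁ - Y₂‖) := by
  have hm₁ : mk2 X₁ Y₁ ∈ ball (0 : Prod2 k₁ k₂) ρ :=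
    mem_ball_zero_iff.2 ((norm_mk2_le _ _).trans_lt h₁)
  have hm₂ : mk2 X₂ Y₂ ∈ ball (0 : Prod2 k₁ k₂) ρ :=
    mem_ball_zero_iff.2 ((norm_mk2_le _ _).trans_lt h₂)
  have hδ : 0 ≤ δ := (norm_nonneg _).trans (hS _ hm₁).2
  refine ((convex_ball (0 : Prod2 k₁ k₂) ρ).norm_image_sub_le_of_norm_fderiv_le
    (fun Z hZ => (hS Z hZ).1) (fun Z hZ => (hS Z hZ).2) hm₂ hm₁).trans ?_
  rw [mk2_sub]
  gcongr
  exact norm_mk2_le _ _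

theorem norm_comp_graph_sub_le {k₁ k₂ : ℕ} {E : Type*} [NormedAddCommGroup E] [NormedSpace ℂ E]
    {S : Prod2 k₁ k₂ → E} {ρ δ κ : ℝ}
    (hS : ∀ Z ∈ ball (0 : Prod2 k₁ k₂) ρ, DifferentiableAt ℂ S Z ∧ ‖fderiv ℂ S Z‖ ≤ δ)
    {X₁ X₂ : Eu k₁} {φ : Eu k₁ → Eu k₂} (h₁ : ‖X₁‖ + ‖φ X₁‖ < ρ) (h₂ : ‖X₂‖ + ‖φ X₂‖ < ρ)
    (hκ : κ ≤ 1) (hφ : ‖φ X₁ - φ X₂‖ ≤ κ * ‖X₁ - X₂‖) :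
    ‖S (mk2 X₁ (φ X₁)) - S (mk2 X₂ (φ X₂))‖ ≤ δ * (2 * ‖X₁ - X₂‖) := by
  have hδ : 0 ≤ δ :=
    (norm_nonneg _).trans (hS _ (mem_ball_zero_iff.2 ((norm_mk2_le _ _).trans_lt h₁))).2
  refine (norm_apply_mk2_sub_le hS h₁ h₂).trans ?_
  gcongr
  linarith [hφ.trans (mul_le_of_le_one_left (norm_nonneg (X₁ - X₂)) hκ)]

/-- Forward push of horizontal graphs in Pesin-type coordinates
(abstract form of Lemma 1). -/
theorem forward_push_pesin_coordinates
    (γ γ₀ : ℝ) (hγ : 0 < γ) (hγ₀ : 0 < γ₀) (hγ₀1 : γ₀ ≤ 1)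
    (hγ₀γ : γ₀ < Real.exp (γ / 4) - 1) :
    ∃ h₀ > (0 : ℝ), ∀ (k₁ k₂ : ℕ), 0 < k₁ → 0 < k₂ →
      ∀ (A : Eu k₁ ≃L[ℂ] Eu k₁) (B : Eu k₂ →L[ℂ] Eu k₂)
        (R : Prod2 k₁ k₂ → Eu k₁) (U : Prod2 k₁ k₂ → Eu k₂)
        (g : Prod2 k₁ k₂ → Prod2 k₁ k₂) (h r r' : ℝ),
        0 < h → h ≤ h₀ → 0 < r → r ≤ 1 → 0 < r' → r' ≤ 1 →
        Real.exp (-γ) ≤ r' / r → r' / r ≤ Real.exp γ →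
        (∀ Z, g Z = mk2 (A (fst2 Z) + R Z) (B (snd2 Z) + U Z)) →
        g 0 = 0 →
        (∀ Z ∈ ball (0 : Prod2 k₁ k₂) (5 * h * r),
          DifferentiableAt ℂ R Z ∧ ‖fderiv ℂ R Z‖ ≤ 5 * h) →
        (∀ Z ∈ ball (0 : Prod2 k₁ k₂) (5 * h * r),
          DifferentiableAt ℂ U Z ∧ ‖fderiv ℂ U Z‖ ≤ 5 * h) →
        Real.exp (4 * γ) ≤ ‖(A.symm : Eu k₁ →L[ℂ] Eu k₁)‖⁻¹ →
        ‖B‖ ≤ Real.exp (-(4 * γ)) →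
        ∀ φ : Eu k₁ → Eu k₂,
          (∀ X₁ ∈ ball (0 : Eu k₁) (h * r), ∀ X₂ ∈ ball (0 : Eu k₁) (h * r),
            ‖φ X₁ - φ X₂‖ ≤ γ₀ * ‖X₁ - X₂‖) →
          ‖φ 0‖ ≤ h * r →
          ∃ (ψ : Eu k₁ → Eu k₂) (Dom : Set (Eu k₁)),
            ball (0 : Eu k₁) (h * r' * Real.exp γ) ⊆ Dom ∧
            g '' hgraph φ (ball (0 : Eu k₁) (h * r)) = hgraph ψ Dom ∧
            ‖ψ 0‖ ≤ Real.exp (-(2 * γ)) * ‖φ 0‖ ∧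
            (∀ X₁ ∈ Dom, ∀ X₂ ∈ Dom, ‖ψ X₁ - ψ X₂‖ ≤ γ₀ * Real.exp (-γ) * ‖X₁ - X₂‖) := by
  set a : ℝ := Real.exp (-(2 * γ)) with ha
  have ha0 : 0 < a := Real.exp_pos _
  have ha1 : a < 1 := Real.exp_lt_one_iff.2 (by linarith)
  have ha2 : Real.exp (-(4 * γ)) = a ^ 2 := by rw [ha, ← Real.exp_nat_mul]; congr 1; push_cast; ring
  set m : ℝ := Real.exp (2 * γ) with hm
  have hm1 : 1 < m := Real.one_lt_exp_iff.2 (by linarith)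
  have hm2 : Real.exp (4 * γ) = m ^ 2 := by rw [hm, ← Real.exp_nat_mul]; congr 1; push_cast; ring
  have hmγ : Real.exp γ * Real.exp γ = m := by rw [hm, ← Real.exp_add]; congr 1; ring
  have hKm : Real.exp (-γ) * m = Real.exp γ := by rw [hm, ← Real.exp_add]; congr 1; ring
  have hexp1 : 1 < Real.exp γ := Real.one_lt_exp_iff.2 hγ
  have haa : 0 < a - a ^ 2 := sub_pos.2 (pow_lt_self_of_lt_one₀ ha0 ha1 one_lt_two)
  refine ⟨γ₀ * (a - a ^ 2) / 15, by positivity, ?_⟩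
  intro k₁ k₂ _ _ A B R U g h r r' hh hh₀ hr _ hr' _ _ hrr hg hg0 hR hU hA hB φ hφ hφ0
  rw [hm2] at hA
  rw [ha2] at hB
  have hhr : 0 < h * r := mul_pos hh hr
  have h15 : 15 * h ≤ γ₀ * (a - a ^ 2) := by linarith
  have h15a : 15 * h ≤ a - a ^ 2 := h15.trans (mul_le_of_le_one_left haa.le hγ₀1)
  have h15m : m + 15 * h ≤ m ^ 2 := by
    have ham : a * m = 1 := by rw [ha, hm, ← Real.exp_add, neg_add_cancel, Real.exp_zero]
    nlinarith only [h15a, ham, mul_pos (sub_pos.2 hm1) (sub_pos.2 hm1),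
      mul_pos (sub_pos.2 hm1) (sub_pos.2 ha1), mul_pos (sub_pos.2 ha1) (sub_pos.2 ha1)]
  have h1 : 15 * h ≤ 1 := by linarith [sq_nonneg a]
  have hr'm : h * r' * Real.exp γ ≤ m * (h * r) := by
    rw [div_le_iff₀ hr] at hrr
    calc h * r' * Real.exp γ ≤ h * (Real.exp γ * r) * Real.exp γ := by gcongr
      _ = Real.exp γ * Real.exp γ * (h * r) := by ring
      _ = m * (h * r) := by rw [hmγ]
  have hzero : mk2 (R 0) (U 0) = (0 : Prod2 k₁ k₂) := by
    have h₁ : fst2 (0 : Prod2 k₁ k₂) = 0 := rfl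
    have h₂ : snd2 (0 : Prod2 k₁ k₂) = 0 := rfl
    simpa only [hg 0, h₁, h₂, map_zero, zero_add] using hg0
  have hR0 : R (mk2 0 0) = 0 := congrArg fst2 hzero
  have hU0 : U (mk2 0 0) = 0 := congrArg snd2 hzero
  have h0mem : (0 : Eu k₁) ∈ ball (0 : Eu k₁) (h * r) := mem_ball_self hhr
  have hφX : ∀ X ∈ ball (0 : Eu k₁) (h * r), ‖φ X‖ ≤ ‖φ 0‖ + ‖X‖ := by
    intro X hX
    have hL := hφ X hX 0 h0mem
    rw [sub_zero] at hL
    linarith [norm_le_norm_add_norm_sub' (φ X) (φ 0),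
      mul_le_of_le_one_left (norm_nonneg X) hγ₀1]
  have hsmall : ∀ X ∈ ball (0 : Eu k₁) (h * r), ‖X‖ + ‖φ X‖ < 5 * h * r := by
    intro X hX
    have := hφX X hX
    rw [mem_ball_zero_iff] at hX
    linarith
  have hsmall0 : ‖(0 : Eu k₁)‖ + ‖(0 : Eu k₂)‖ < 5 * h * r := by
    rw [norm_zero, norm_zero]; linarith
  have hRlip : ∀ X₁ ∈ ball (0 : Eu k₁) (h * r), ∀ X₂ ∈ ball (0 : Eu k₁) (h * r),
      ‖R (mk2 X₁ (φ X₁)) - R (mk2 X₂ (φ X₂))‖ ≤ 10 * h * ‖X₁ - X₂‖ := by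
    intro X₁ hX₁ X₂ hX₂
    linarith [norm_comp_graph_sub_le hR (hsmall X₁ hX₁) (hsmall X₂ hX₂) hγ₀1 (hφ X₁ hX₁ X₂ hX₂)]
  have hUlip : ∀ X₁ ∈ ball (0 : Eu k₁) (h * r), ∀ X₂ ∈ ball (0 : Eu k₁) (h * r),
      ‖U (mk2 X₁ (φ X₁)) - U (mk2 X₂ (φ X₂))‖ ≤ 10 * h * ‖X₁ - X₂‖ := by
    intro X₁ hX₁ X₂ hX₂
    linarith [norm_comp_graph_sub_le hU (hsmall X₁ hX₁) (hsmall X₂ hX₂) hγ₀1 (hφ X₁ hX₁ X₂ hX₂)]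
  have hRnorm : ∀ X ∈ ball (0 : Eu k₁) (h * r),
      ‖R (mk2 X (φ X))‖ ≤ 5 * h * (‖X‖ + ‖φ X‖) := by
    intro X hX
    simpa [hR0] using norm_apply_mk2_sub_le hR (hsmall X hX) hsmall0
  have hUnorm : ∀ X ∈ ball (0 : Eu k₁) (h * r),
      ‖U (mk2 X (φ X))‖ ≤ 5 * h * (‖X‖ + ‖φ X‖) := by
    intro X hX
    simpa [hU0] using norm_apply_mk2_sub_le hU (hsmall X hX) hsmall0
  set F : Eu k₁ → Eu k₁ := fun X => A X + R (mk2 X (φ X)) with hF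
  set G : Eu k₁ → Eu k₂ := fun X => B (φ X) + U (mk2 X (φ X)) with hG
  have hgFG : ∀ X, g (mk2 X (φ X)) = mk2 (F X) (G X) := fun X => hg _
  have hAlow := mul_norm_le_norm_apply (A := A) (by positivity) hA
  have hFexp : ∀ X₁ ∈ ball (0 : Eu k₁) (h * r), ∀ X₂ ∈ ball (0 : Eu k₁) (h * r),
      m * ‖X₁ - X₂‖ ≤ ‖F X₁ - F X₂‖ := by
    intro X₁ hX₁ X₂ hX₂
    have hdecomp : A (X₁ - X₂) =
        (F X₁ - F X₂) - (R (mk2 X₁ (φ X₁)) - R (mk2 X₂ (φ X₂))) := by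
      simp only [hF, map_sub]; abel
    have hle := norm_sub_le (F X₁ - F X₂) (R (mk2 X₁ (φ X₁)) - R (mk2 X₂ (φ X₂)))
    rw [← hdecomp] at hle
    have hmh := mul_le_mul_of_nonneg_right h15m (norm_nonneg (X₁ - X₂))
    have hhX : 0 ≤ h * ‖X₁ - X₂‖ := by positivity
    linarith [hAlow (X₁ - X₂), hRlip X₁ hX₁ X₂ hX₂]
  have hGlip : ∀ X₁ ∈ ball (0 : Eu k₁) (h * r), ∀ X₂ ∈ ball (0 : Eu k₁) (h * r),
      ‖G X₁ - G X₂‖ ≤ (a ^ 2 * γ₀ + 10 * h) * ‖X₁ - X₂‖ := by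
    intro X₁ hX₁ X₂ hX₂
    have hdecomp : G X₁ - G X₂ =
        B (φ X₁ - φ X₂) + (U (mk2 X₁ (φ X₁)) - U (mk2 X₂ (φ X₂))) := by
      simp only [hG, map_sub]; abel
    have hBφ : ‖B (φ X₁ - φ X₂)‖ ≤ a ^ 2 * (γ₀ * ‖X₁ - X₂‖) :=
      B.le_of_opNorm_le_of_le hB (hφ X₁ hX₁ X₂ hX₂)
    rw [hdecomp]
    linarith [norm_add_le (B (φ X₁ - φ X₂)) (U (mk2 X₁ (φ X₁)) - U (mk2 X₂ (φ X₂))),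
      hUlip X₁ hX₁ X₂ hX₂]
  have happrox : ApproximatesLinearOn F (A : Eu k₁ →L[ℂ] Eu k₁) (ball 0 (h * r))
      (10 * h).toNNReal := by
    intro X₁ hX₁ X₂ hX₂
    rw [Real.coe_toNNReal _ (by positivity)]
    have hdecomp : F X₁ - F X₂ - (A : Eu k₁ →L[ℂ] Eu k₁) (X₁ - X₂) =
        R (mk2 X₁ (φ X₁)) - R (mk2 X₂ (φ X₂)) := by
      simp only [hF, map_sub, ContinuousLinearEquiv.coe_coe]; abel
    rw [hdecomp]
    exact hRlip X₁ hX₁ X₂ hX₂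
  have hF0 : ‖F 0‖ ≤ 5 * h * (h * r) := by
    have hR00 := hRnorm 0 h0mem
    simp only [hF, map_zero, zero_add]
    rw [norm_zero, zero_add] at hR00
    exact hR00.trans (by gcongr)
  have hcover : ball (0 : Eu k₁) (h * r' * Real.exp γ) ⊆ F '' ball 0 (h * r) := by
    refine ball_subset_image_of_approximatesLinearOn happrox hA ?_ ?_ <;>
      rw [Real.coe_toNNReal _ (by positivity)]
    · linarith
    · have := mul_le_mul_of_nonneg_right h15m hhr.le
      linarith
  have hLK : a ^ 2 * γ₀ + 10 * h ≤ γ₀ * Real.exp (-γ) * m := by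
    rw [mul_assoc, hKm]
    nlinarith only [h15, hh, hexp1, ha0, ha1, hγ₀]
  obtain ⟨ψ, hψ, hψlip⟩ := exists_graph_of_expanding (by linarith) (by positivity) hLK hFexp hGlip
  refine ⟨ψ, F '' ball 0 (h * r), hcover, ?_, ?_, hψlip⟩
  · simp only [hgraph, image_image]
    exact image_congr fun X hX => by rw [hgFG, hψ X hX]
  · obtain ⟨X, hX, hFX⟩ := hcover (mem_ball_self (by positivity))
    have hψ0 : ψ 0 = G X := by rw [← hψ X hX, hFX]
    rw [hψ0]
    have hAX : ‖A X‖ = ‖R (mk2 X (φ X))‖ := by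
      rw [eq_neg_of_add_eq_zero_left hFX, norm_neg]
    have hXφ : ‖X‖ ≤ 5 * h * ‖φ 0‖ := by
      have hφh := mul_le_mul_of_nonneg_left (hφX X hX) hh.le
      have hmX : (1 + 15 * h) * ‖X‖ ≤ m ^ 2 * ‖X‖ := by gcongr; linarith
      have hhX : 0 ≤ h * ‖X‖ := by positivity
      linarith [hAlow X, hRnorm X hX]
    have hBφ : ‖B (φ X)‖ ≤ a ^ 2 * (‖φ 0‖ + ‖X‖) := B.le_of_opNorm_le_of_le hB (hφX X hX)
    have ha21 : a ^ 2 * ‖X‖ ≤ ‖X‖ := mul_le_of_le_one_left (norm_nonneg X) (pow_le_one₀ ha0.le ha1.le)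
    have hUX : ‖U (mk2 X (φ X))‖ ≤ 5 * h * ‖φ 0‖ + 10 * h * ‖X‖ := by
      linarith [hUnorm X hX, mul_le_mul_of_nonneg_left (hφX X hX) hh.le]
    have hhX : 10 * h * ‖X‖ ≤ ‖X‖ := mul_le_of_le_one_left (norm_nonneg X) (by linarith)
    have hsum : 15 * h * ‖φ 0‖ ≤ (a - a ^ 2) * ‖φ 0‖ := by gcongr
    have hGX := norm_add_le (B (φ X)) (U (mk2 X (φ X)))
    simp only [hG]
    linarith
end
end

section
/- Backward pull of vertical graphs in Pesin-type coordinates (abstract form of Lemma 2): Let γ > 0 with e^{2γ} < 3/2 and 0 < γ₀ ≤ 1 with γ₀ < 1/5. There exists h₀ > 0, depending only on γ and γ₀, with the following property. Let h ∈ (0, h₀], let r, r′ ∈ (0,1] with e^{−γ} ≤ r′/r ≤ e^{γ}, and suppose g is as in the setting with R₀ = 5hr and δ = 5h (i.e. g is holomorphic on B_k(0, 5hr), g(0)=0, and max(‖DR‖,‖DU‖) ≤ 5h on B_k(0,5hr)), and that ‖A⁻¹‖⁻¹ ≥ e^{4γ} and ‖B‖ ≤ e^{−4γ}. Then for every ψ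 : B_{k₂}(0, hr′) → ℂ^{k₁} with Lip(ψ) ≤ γ₀ and ‖ψ(0)‖ ≤ hr′, there exists φ : B_{k₂}(0, e^{2γ} h r′) → ℂ^{k₁} with g(vertical graph of φ) ⊆ vertical graph of ψ, ‖φ(0)‖ ≤ e^{−2γ}‖ψ(0)‖ and Lip(φ) ≤ e^{−γ}γ₀. -/
open Metric Set

noncomputable section

/-- A contraction of a closed ball of a complete normed space has a fixed point there. -/
theorem exists_fixedPoint_closedBall {E : Type*} [NormedAddCommGroup E] [CompleteSpace E]
    {T : E → E} {ρ K : ℝ} (hρ : 0 ≤ ρ) (hK : 0 ≤ K) (hK1 : K < 1)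
    (hmaps : ∀ x, ‖x‖ ≤ ρ → ‖T x‖ ≤ ρ)
    (hlip : ∀ x y, ‖x‖ ≤ ρ → ‖y‖ ≤ ρ → ‖T x - T y‖ ≤ K * ‖x - y‖) :
    ∃ x, ‖x‖ ≤ ρ ∧ T x = x := by
  have hs : MapsTo T (closedBall (0 : E) ρ) (closedBall 0 ρ) := fun x hx => by
    simpa using hmaps x (by simpa using hx)
  have hc : ContractingWith ⟨K, hK⟩ (hs.restrict T _ _) := by
    refine ⟨by exact_mod_cast hK1, LipschitzWith.of_dist_le_mul fun x y => ?_⟩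
    have := hlip x y (mem_closedBall_zero_iff.1 x.2) (mem_closedBall_zero_iff.1 y.2)
    rwa [← dist_eq_norm, ← dist_eq_norm] at this
  obtain ⟨x, hx, hfix, -⟩ := hc.exists_fixedPoint' isClosed_closedBall.isComplete hs
    (mem_closedBall_self hρ) (edist_ne_top _ _)
  exact ⟨x, by simpa using hx, hfix⟩

/-- Backward graph transform: solve `X = S (ψ (B Y + U X Y) - R X Y)` for `X` as a function
of `Y`, where `S` and `B` have norm at most `b` and `R`, `U` are `δ`-Lipschitz. -/
theorem exists_backward_graph_transform {E F : Type*}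
    [NormedAddCommGroup E] [NormedSpace ℂ E] [CompleteSpace E]
    [NormedAddCommGroup F] [NormedSpace ℂ F]
    (S : E →L[ℂ] E) (B : F →L[ℂ] F) (R : E → F → E) (U : E → F → F) (ψ : F → E)
    {b c δ ρ τ σ : ℝ} (hb : 0 ≤ b) (hb1 : b ≤ 1) (hc : 0 ≤ c) (hc1 : c ≤ 1)
    (hδ : 0 ≤ δ) (hδ1 : 2 * δ < 1) (hρ : 0 ≤ ρ) (hτ : 0 < τ)
    (hS : ‖S‖ ≤ b) (hB : ‖B‖ ≤ b) (hR0 : R 0 0 = 0) (hU0 : U 0 0 = 0)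
    (hR : ∀ X₁ X₂ Y₁ Y₂, ‖X₁‖ ≤ ρ → ‖X₂‖ ≤ ρ → ‖Y₁‖ < τ → ‖Y₂‖ < τ →
      ‖R X₁ Y₁ - R X₂ Y₂‖ ≤ δ * (‖X₁ - X₂‖ + ‖Y₁ - Y₂‖))
    (hU : ∀ X₁ X₂ Y₁ Y₂, ‖X₁‖ ≤ ρ → ‖X₂‖ ≤ ρ → ‖Y₁‖ < τ → ‖Y₂‖ < τ →
      ‖U X₁ Y₁ - U X₂ Y₂‖ ≤ δ * (‖X₁ - X₂‖ + ‖Y₁ - Y₂‖))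
    (hψ : ∀ Y₁ ∈ ball (0 : F) σ, ∀ Y₂ ∈ ball (0 : F) σ, ‖ψ Y₁ - ψ Y₂‖ ≤ c * ‖Y₁ - Y₂‖)
    (hσ : b * τ + δ * (ρ + τ) < σ)
    (hself : b * b * c * τ + 2 * δ * (ρ + τ) + b * ‖ψ 0‖ ≤ ρ) :
    ∃ φ : F → E,
      (∀ Y ∈ ball (0 : F) τ, B Y + U (φ Y) Y ∈ ball (0 : F) σ ∧
        φ Y = S (ψ (B Y + U (φ Y) Y) - R (φ Y) Y)) ∧
      (1 - 2 * δ) * ‖φ 0‖ ≤ b * ‖ψ 0‖ ∧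
      ∀ Y₁ ∈ ball (0 : F) τ, ∀ Y₂ ∈ ball (0 : F) τ,
        (1 - 2 * δ) * ‖φ Y₁ - φ Y₂‖ ≤ (b * b * c + 2 * δ) * ‖Y₁ - Y₂‖ := by
  set T : F → E → E := fun Y X => S (ψ (B Y + U X Y) - R X Y) with hT
  have hdom : ∀ X Y, ‖X‖ ≤ ρ → ‖Y‖ < τ → B Y + U X Y ∈ ball (0 : F) σ := by
    intro X Y hX hY
    have h1 : ‖U X Y‖ ≤ δ * (‖X‖ + ‖Y‖) := by
      simpa [hU0] using hU X 0 Y 0 hX (by simpa using hρ) hY (by simpa using hτ)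
    have h2 : ‖B Y‖ ≤ b * ‖Y‖ := B.le_of_opNorm_le hB Y
    have h3 : b * ‖Y‖ ≤ b * τ := by gcongr
    have h4 : δ * (‖X‖ + ‖Y‖) ≤ δ * (ρ + τ) := by gcongr
    rw [mem_ball_zero_iff]
    linarith [norm_add_le (B Y) (U X Y)]
  have hest : ∀ X₁ X₂ Y₁ Y₂, ‖X₁‖ ≤ ρ → ‖X₂‖ ≤ ρ → ‖Y₁‖ < τ → ‖Y₂‖ < τ →
      ‖T Y₁ X₁ - T Y₂ X₂‖ ≤
        b * b * c * ‖Y₁ - Y₂‖ + 2 * δ * (‖X₁ - X₂‖ + ‖Y₁ - Y₂‖) := by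
    intro X₁ X₂ Y₁ Y₂ hX₁ hX₂ hY₁ hY₂
    have hr := hR X₁ X₂ Y₁ Y₂ hX₁ hX₂ hY₁ hY₂
    have hu := hU X₁ X₂ Y₁ Y₂ hX₁ hX₂ hY₁ hY₂
    have hp := hψ _ (hdom X₁ Y₁ hX₁ hY₁) _ (hdom X₂ Y₂ hX₂ hY₂)
    set D := δ * (‖X₁ - X₂‖ + ‖Y₁ - Y₂‖) with hD
    have hD0 : 0 ≤ D := by positivity
    have hin : ‖B Y₁ + U X₁ Y₁ - (B Y₂ + U X₂ Y₂)‖ ≤ b * ‖Y₁ - Y₂‖ + D := by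
      have e : B Y₁ + U X₁ Y₁ - (B Y₂ + U X₂ Y₂) = B (Y₁ - Y₂) + (U X₁ Y₁ - U X₂ Y₂) := by
        rw [map_sub]; abel
      rw [e]
      exact (norm_add_le _ _).trans (add_le_add (B.le_of_opNorm_le hB _) hu)
    have hp' := hp.trans (mul_le_mul_of_nonneg_left hin hc)
    have e : T Y₁ X₁ - T Y₂ X₂ = S ((ψ (B Y₁ + U X₁ Y₁) - ψ (B Y₂ + U X₂ Y₂)) -
        (R X₁ Y₁ - R X₂ Y₂)) := by
      simp only [hT, map_sub]; abel
    rw [e]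
    calc _ ≤ b * ‖(ψ (B Y₁ + U X₁ Y₁) - ψ (B Y₂ + U X₂ Y₂)) - (R X₁ Y₁ - R X₂ Y₂)‖ :=
          S.le_of_opNorm_le hS _
      _ ≤ b * (c * (b * ‖Y₁ - Y₂‖ + D) + D) := by
          gcongr
          exact (norm_sub_le _ _).trans (add_le_add hp' hr)
      _ = b * b * c * ‖Y₁ - Y₂‖ + b * c * D + b * D := by ring
      _ ≤ b * b * c * ‖Y₁ - Y₂‖ + 1 * D + 1 * D := by
          gcongr
          exact mul_le_one₀ hb1 hc hc1
      _ = _ := by rw [hD]; ring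
  have hT0 : ‖T 0 0‖ ≤ b * ‖ψ 0‖ := by
    simpa [hT, hR0, hU0] using S.le_of_opNorm_le hS (ψ 0)
  have hfix : ∀ Y : F, ∃ X : E, ‖Y‖ < τ → ‖X‖ ≤ ρ ∧ T Y X = X := by
    intro Y
    by_cases hY : ‖Y‖ < τ
    · obtain ⟨X, hX⟩ := exists_fixedPoint_closedBall (T := T Y) hρ (by positivity) hδ1
        (fun X hX => by
          have h1 := hest X 0 Y 0 hX (by simpa using hρ) hY (by simpa using hτ)
          rw [sub_zero, sub_zero] at h1
          have h2 : b * b * c * ‖Y‖ + 2 * δ * (‖X‖ + ‖Y‖) ≤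
              b * b * c * τ + 2 * δ * (ρ + τ) := by gcongr
          linarith [norm_le_norm_sub_add (T Y X) (T 0 0)])
        (fun X₁ X₂ h₁ h₂ => by simpa using hest X₁ X₂ Y Y h₁ h₂ hY hY)
      exact ⟨X, fun _ => hX⟩
    · exact ⟨0, fun h => absurd h hY⟩
  choose φ hφ using hfix
  refine ⟨φ, fun Y hY => ?_, ?_, fun Y₁ h₁ Y₂ h₂ => ?_⟩
  · obtain ⟨h1, h2⟩ := hφ Y (by simpa using hY)
    exact ⟨hdom _ _ h1 (by simpa using hY), h2.symm⟩
  · have h0 : ‖(0 : F)‖ < τ := by simpa using hτ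
    obtain ⟨h1, h2⟩ := hφ 0 h0
    have h3 := hest (φ 0) 0 0 0 h1 (by simpa using hρ) h0 h0
    rw [h2, sub_self, norm_zero, sub_zero] at h3
    linarith [norm_le_norm_sub_add (φ 0) (T 0 0)]
  · rw [mem_ball_zero_iff] at h₁ h₂
    obtain ⟨a₁, e₁⟩ := hφ Y₁ h₁
    obtain ⟨a₂, e₂⟩ := hφ Y₂ h₂
    have h3 := hest _ _ _ _ a₁ a₂ h₁ h₂
    rw [e₁, e₂] at h3
    linarith

/-- A map with derivative bounded by `δ` on a ball is `δ`-Lipschitz in the pair of coordinates. -/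
theorem norm_sub_mk2_le_of_fderiv_le {k₁ k₂ : ℕ} {G : Type*} [NormedAddCommGroup G]
    [NormedSpace ℂ G] {f : Prod2 k₁ k₂ → G} {δ s ρ τ : ℝ} (hδ : 0 ≤ δ) (hs : ρ + τ ≤ s)
    (hf : ∀ Z ∈ ball (0 : Prod2 k₁ k₂) s, DifferentiableAt ℂ f Z ∧ ‖fderiv ℂ f Z‖ ≤ δ)
    (X₁ X₂ : Eu k₁) (Y₁ Y₂ : Eu k₂)
    (hX₁ : ‖X₁‖ ≤ ρ) (hX₂ : ‖X₂‖ ≤ ρ) (hY₁ : ‖Y₁‖ < τ) (hY₂ : ‖Y₂‖ < τ) :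
    ‖f (mk2 X₁ Y₁) - f (mk2 X₂ Y₂)‖ ≤ δ * (‖X₁ - X₂‖ + ‖Y₁ - Y₂‖) := by
  have hmem : ∀ (X : Eu k₁) (Y : Eu k₂), ‖X‖ ≤ ρ → ‖Y‖ < τ →
      mk2 X Y ∈ ball (0 : Prod2 k₁ k₂) s := fun X Y hX hY => by
    rw [mem_ball_zero_iff]
    linarith [norm_mk2_le X Y]
  refine ((convex_ball _ _).norm_image_sub_le_of_norm_fderiv_le (𝕜 := ℂ) (fun Z hZ => (hf Z hZ).1)
    (fun Z hZ => (hf Z hZ).2) (hmem X₂ Y₂ hX₂ hY₂) (hmem X₁ Y₁ hX₁ hY₁)).trans ?_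
  rw [mk2_sub]
  gcongr
  exact norm_mk2_le _ _

/-- Backward pull of vertical graphs in Pesin-type coordinates
(abstract form of Lemma 2). -/
theorem backward_pull_pesin_coordinates
    (γ γ₀ : ℝ) (hγ : 0 < γ) (hγ32 : Real.exp (2 * γ) < 3 / 2)
    (hγ₀ : 0 < γ₀) (hγ₀1 : γ₀ ≤ 1) (hγ₀5 : γ₀ < 1 / 5) :
    ∃ h₀ > (0 : ℝ), ∀ (k₁ k₂ : ℕ), 0 < k₁ → 0 < k₂ →
      ∀ (A : Eu k₁ ≃L[ℂ] Eu k₁) (B : Eu k₂ →L[ℂ] Eu k₂)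
        (R : Prod2 k₁ k₂ → Eu k₁) (U : Prod2 k₁ k₂ → Eu k₂)
        (g : Prod2 k₁ k₂ → Prod2 k₁ k₂) (h r r' : ℝ),
        0 < h → h ≤ h₀ → 0 < r → r ≤ 1 → 0 < r' → r' ≤ 1 →
        Real.exp (-γ) ≤ r' / r → r' / r ≤ Real.exp γ →
        (∀ Z, g Z = mk2 (A (fst2 Z) + R Z) (B (snd2 Z) + U Z)) →
        g 0 = 0 →
        (∀ Z ∈ ball (0 : Prod2 k₁ k₂) (5 * h * r),
          DifferentiableAt ℂ R Z ∧ ‖fderiv ℂ R Z‖ ≤ 5 * h) →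
        (∀ Z ∈ ball (0 : Prod2 k₁ k₂) (5 * h * r),
          DifferentiableAt ℂ U Z ∧ ‖fderiv ℂ U Z‖ ≤ 5 * h) →
        Real.exp (4 * γ) ≤ ‖(A.symm : Eu k₁ →L[ℂ] Eu k₁)‖⁻¹ →
        ‖B‖ ≤ Real.exp (-(4 * γ)) →
        ∀ ψ : Eu k₂ → Eu k₁,
          (∀ Y₁ ∈ ball (0 : Eu k₂) (h * r'), ∀ Y₂ ∈ ball (0 : Eu k₂) (h * r'),
            ‖ψ Y₁ - ψ Y₂‖ ≤ γ₀ * ‖Y₁ - Y₂‖) →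
          ‖ψ 0‖ ≤ h * r' →
          ∃ φ : Eu k₂ → Eu k₁,
            g '' vgraph φ (ball (0 : Eu k₂) (Real.exp (2 * γ) * h * r')) ⊆
              vgraph ψ (ball (0 : Eu k₂) (h * r')) ∧
            ‖φ 0‖ ≤ Real.exp (-(2 * γ)) * ‖ψ 0‖ ∧
            (∀ Y₁ ∈ ball (0 : Eu k₂) (Real.exp (2 * γ) * h * r'),
              ∀ Y₂ ∈ ball (0 : Eu k₂) (Real.exp (2 * γ) * h * r'),
                ‖φ Y₁ - φ Y₂‖ ≤ Real.exp (-γ) * γ₀ * ‖Y₁ - Y₂‖) := by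
  have hq1 : Real.exp (-(2 * γ)) < 1 := Real.exp_lt_one_iff.2 (by linarith)
  have hq8 : Real.exp (-(8 * γ)) < Real.exp (-γ) := Real.exp_lt_exp.2 (by linarith)
  refine ⟨min (1 / 200) (min ((1 - Real.exp (-(2 * γ))) / 50)
    (γ₀ * (Real.exp (-γ) - Real.exp (-(8 * γ))) / 20)), ?_, ?_⟩
  · exact lt_min (by norm_num) (lt_min (by linarith)
      (div_pos (mul_pos hγ₀ (sub_pos.2 hq8)) (by norm_num)))
  intro k₁ k₂ _ _ A B R U g h r r' hh hle hr _ hr' _ hrr₁ hrr₂ hg hg0 hR hU hA hB ψ hψ hψ0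
  obtain ⟨hh1, hh2, hh3⟩ : h ≤ 1 / 200 ∧ h ≤ (1 - Real.exp (-(2 * γ))) / 50 ∧
      h ≤ γ₀ * (Real.exp (-γ) - Real.exp (-(8 * γ))) / 20 := by
    simpa only [le_min_iff] using hle
  have hg1 : Real.exp γ ≤ 5 / 4 := by
    have : Real.exp (2 * γ) = Real.exp γ * Real.exp γ := by rw [← Real.exp_add]; ring_nf
    by_contra! hcon
    nlinarith
  have hinv : Real.exp (-γ) * Real.exp γ = 1 := by rw [← Real.exp_add]; simp
  have hr'r : r' ≤ 5 / 4 * r := (div_le_iff₀ hr).1 (hrr₂.trans hg1)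
  have hrr' : r ≤ 5 / 4 * r' := by
    have h1 := (le_div_iff₀ hr).1 hrr₁
    have h2 : Real.exp γ * (Real.exp (-γ) * r) ≤ Real.exp γ * r' := by gcongr
    have h3 : Real.exp γ * r' ≤ 5 / 4 * r' := by gcongr
    have h4 : Real.exp γ * (Real.exp (-γ) * r) = r := by
      rw [← mul_assoc, mul_comm (Real.exp γ), hinv, one_mul]
    linarith
  have hb1 : Real.exp (-(4 * γ)) ≤ 1 := Real.exp_le_one_iff.2 (by linarith)
  have hS : ‖(A.symm : Eu k₁ →L[ℂ] Eu k₁)‖ ≤ Real.exp (-(4 * γ)) := by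
    have hpos := inv_pos.1 ((Real.exp_pos _).trans_le hA)
    rw [Real.exp_neg]
    exact (le_inv_comm₀ (Real.exp_pos _) hpos).1 hA
  have hhr : 0 < h * r := mul_pos hh hr
  have hhr' : 0 < h * r' := mul_pos hh hr'
  have hτ : Real.exp (2 * γ) * h * r' ≤ 15 / 8 * (h * r) := by
    have h1 : Real.exp (2 * γ) * (h * r') ≤ 3 / 2 * (h * r') := by gcongr
    have h2 : h * r' ≤ h * (5 / 4 * r) := by gcongr
    linarith
  have hτ0 : 0 < Real.exp (2 * γ) * h * r' := by positivity
  have hbτ : Real.exp (-(4 * γ)) * (Real.exp (2 * γ) * h * r') =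
      Real.exp (-(2 * γ)) * (h * r') := by
    rw [← mul_assoc, ← mul_assoc, ← Real.exp_add, mul_assoc]; ring_nf
  have h00 : mk2 (R 0) (U 0) = (mk2 0 0 : Prod2 k₁ k₂) := by
    have h1 := hg 0
    rw [hg0] at h1
    have e1 : fst2 (0 : Prod2 k₁ k₂) = 0 := rfl
    have e2 : snd2 (0 : Prod2 k₁ k₂) = 0 := rfl
    rw [e1, e2, map_zero, map_zero, zero_add, zero_add] at h1
    exact h1.symm
  have hs : 2 * (h * r) + Real.exp (2 * γ) * h * r' ≤ 5 * h * r := by linarith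
  obtain ⟨φ, hφ, hφ0, hφL⟩ := exists_backward_graph_transform
    (A.symm : Eu k₁ →L[ℂ] Eu k₁) B (fun X Y => R (mk2 X Y)) (fun X Y => U (mk2 X Y)) ψ
    (b := Real.exp (-(4 * γ))) (c := γ₀) (δ := 5 * h) (ρ := 2 * (h * r))
    (τ := Real.exp (2 * γ) * h * r') (σ := h * r')
    (Real.exp_pos _).le hb1 hγ₀.le hγ₀1 (by positivity) (by linarith) (by positivity) hτ0 hS hB
    (congrArg fst2 h00) (congrArg snd2 h00)
    (norm_sub_mk2_le_of_fderiv_le (by positivity) hs hR)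
    (norm_sub_mk2_le_of_fderiv_le (by positivity) hs hU) hψ
    (by
      rw [hbτ]
      have h1 : 5 * h * (2 * (h * r) + Real.exp (2 * γ) * h * r') ≤
          5 * h * (4 * (h * (5 / 4 * r'))) := by
        have : h * r ≤ h * (5 / 4 * r') := by gcongr
        gcongr
        linarith
      have h2 : h * (h * r') ≤ (1 - Real.exp (-(2 * γ))) / 50 * (h * r') := by gcongr
      have h3 : 0 < h * (h * r') := by positivity
      linarith)
    (by
      have h1 : Real.exp (-(4 * γ)) * Real.exp (-(4 * γ)) * γ₀ *
          (Real.exp (2 * γ) * h * r') ≤ 1 * 1 * (1 / 5) * (15 / 8 * (h * r)) := by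
        gcongr
      have h2 : 2 * (5 * h) * (2 * (h * r) + Real.exp (2 * γ) * h * r') ≤
          2 * (5 * (1 / 200)) * (2 * (h * r) + 15 / 8 * (h * r)) := by gcongr
      have h3 : Real.exp (-(4 * γ)) * ‖ψ 0‖ ≤ 1 * (h * (5 / 4 * r)) := by
        gcongr
        exact hψ0.trans (by gcongr)
      linarith)
  refine ⟨φ, ?_, ?_, fun Y₁ h₁ Y₂ h₂ => ?_⟩
  · rintro _ ⟨_, ⟨Y, hY, rfl⟩, rfl⟩
    obtain ⟨hmem, heq⟩ := hφ Y hY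
    refine ⟨_, hmem, ?_⟩
    have h1 : A (φ Y) = ψ (B Y + U (mk2 (φ Y) Y)) - R (mk2 (φ Y) Y) := by
      conv_lhs => rw [heq]
      simp
    change _ = g (mk2 (φ Y) Y)
    have e1 : fst2 (mk2 (φ Y) Y) = φ Y := rfl
    have e2 : snd2 (mk2 (φ Y) Y) = Y := rfl
    rw [hg, e1, e2, h1, sub_add_cancel]
  · have e : Real.exp (-(4 * γ)) = Real.exp (-(2 * γ)) * Real.exp (-(2 * γ)) := by
      rw [← Real.exp_add]; ring_nf
    have h1 : Real.exp (-(4 * γ)) * ‖ψ 0‖ ≤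
        (1 - 2 * (5 * h)) * (Real.exp (-(2 * γ)) * ‖ψ 0‖) := by
      rw [e, mul_assoc]
      gcongr
      linarith
    exact le_of_mul_le_mul_left (hφ0.trans h1) (by linarith)
  · have e : Real.exp (-(4 * γ)) * Real.exp (-(4 * γ)) = Real.exp (-(8 * γ)) := by
      rw [← Real.exp_add]; ring_nf
    have hE : Real.exp (-γ) ≤ 1 := Real.exp_le_one_iff.2 (by linarith)
    have h0 : h * (Real.exp (-γ) * γ₀) ≤ h * (1 * 1) := by gcongr
    have h1 : (Real.exp (-(4 * γ)) * Real.exp (-(4 * γ)) * γ₀ + 2 * (5 * h)) * ‖Y₁ - Y₂‖ ≤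
        (1 - 2 * (5 * h)) * (Real.exp (-γ) * γ₀ * ‖Y₁ - Y₂‖) := by
      rw [e, ← mul_assoc (1 - 2 * (5 * h))]
      refine mul_le_mul_of_nonneg_right ?_ (norm_nonneg _)
      linarith
    exact le_of_mul_le_mul_left ((hφL Y₁ h₁ Y₂ h₂).trans h1) (by linarith)
end
end

section
/- Contraction of the forward graph transform in the uniform metric: Let 0 ≤ γ₀, let φ₁, φ₂ : D → ℂ^{k₂} (D ⊆ ℂ^{k₁}) with Lip(φ₁) ≤ γ₀ and Lip(φ₂) ≤ γ₀ and horizontal graphs contained in B_k(0,R₀). Let ψ₁, ψ₂ be functions (defined on subsets of ℂ^{k₁}) with Lip(ψ₂) ≤ γ₀ whose horizontal graphs contain g(graph φ₁) and g(graph φ₂) respectively. Then for every X ∈ D such that both A X + R(X, φ₁(X)) and A X + R(X, φ₂(X)) lie in the domains of ψ₁ and ψ₂, one has ‖ψ₁(A X + R(X, φ₁(X))) − ψ₂(A X + R(X, φ₁(X)))‖ ≤ (‖B‖ + δ(1+γ₀)) · ‖φ₁(X) − φ₂(X)‖. -/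
open Metric Set

noncomputable section

/-- If `g` maps the graph of `φ` into the graph of `ψ`, then `ψ` sends the horizontal coordinate of
`g (X, φ X)` to its vertical coordinate. -/
lemma apply_eq_of_image_hgraph_subset {k₁ k₂ : ℕ} {g : Prod2 k₁ k₂ → Prod2 k₁ k₂}
    {φ ψ : Eu k₁ → Eu k₂} {D D' : Set (Eu k₁)} (h : g '' hgraph φ D ⊆ hgraph ψ D')
    {X X' : Eu k₁} {Y' : Eu k₂} (hX : X ∈ D) (hgX : g (mk2 X (φ X)) = mk2 X' Y') :
    ψ X' = Y' := by
  obtain ⟨W, -, hW⟩ := h ⟨_, ⟨X, hX, rfl⟩, hgX⟩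
  have hfst : W = X' := congrArg fst2 hW
  have hsnd : ψ W = Y' := congrArg snd2 hW
  rwa [hfst] at hsnd

lemma norm_mk2_sub_mk2_left {k₁ k₂ : ℕ} (X : Eu k₁) (Y Y' : Eu k₂) :
    ‖mk2 X Y - mk2 X Y'‖ = ‖Y - Y'‖ := by
  have h : mk2 X Y - mk2 X Y' = WithLp.toLp 2 ((0 : Eu k₁), Y - Y') := by
    simp [mk2, ← WithLp.toLp_sub]
  rw [h, WithLp.norm_toLp_snd]

/-- A map with derivative bounded by `δ` on a ball is `δ`-Lipschitz along vertical segments. -/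
lemma norm_sub_le_of_fderiv_le_on_ball {k₁ k₂ : ℕ} {F : Type*} [NormedAddCommGroup F]
    [NormedSpace ℂ F] {f : Prod2 k₁ k₂ → F} {r δ : ℝ}
    (hf : ∀ Z ∈ ball (0 : Prod2 k₁ k₂) r, DifferentiableAt ℂ f Z ∧ ‖fderiv ℂ f Z‖ ≤ δ)
    {X : Eu k₁} {Y Y' : Eu k₂} (hY : mk2 X Y ∈ ball (0 : Prod2 k₁ k₂) r)
    (hY' : mk2 X Y' ∈ ball (0 : Prod2 k₁ k₂) r) :
    ‖f (mk2 X Y) - f (mk2 X Y')‖ ≤ δ * ‖Y - Y'‖ := by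
  let _ : NormedSpace ℝ (Prod2 k₁ k₂) := NormedSpace.restrictScalars ℝ ℂ _
  rw [← norm_mk2_sub_mk2_left X Y Y']
  exact (convex_ball (0 : Prod2 k₁ k₂) r).norm_image_sub_le_of_norm_fderiv_le
    (fun Z hZ => (hf Z hZ).1) (fun Z hZ => (hf Z hZ).2) hY' hY

/-- Contraction of the forward graph transform in the uniform
metric. -/
theorem forward_graph_transform_uniform_contraction
    (k₁ k₂ : ℕ) (hk₁ : 0 < k₁) (hk₂ : 0 < k₂)
    (A : Eu k₁ ≃L[ℂ] Eu k₁) (B : Eu k₂ →L[ℂ] Eu k₂)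
    (R : Prod2 k₁ k₂ → Eu k₁) (U : Prod2 k₁ k₂ → Eu k₂)
    (g : Prod2 k₁ k₂ → Prod2 k₁ k₂) (R₀ δ : ℝ)
    (hR₀ : 0 < R₀) (hδ : 0 ≤ δ)
    (hg : ∀ Z, g Z = mk2 (A (fst2 Z) + R Z) (B (snd2 Z) + U Z))
    (hg0 : g 0 = 0)
    (hRdiff : ∀ Z ∈ ball (0 : Prod2 k₁ k₂) R₀, DifferentiableAt ℂ R Z ∧ ‖fderiv ℂ R Z‖ ≤ δ)
    (hUdiff : ∀ Z ∈ ball (0 : Prod2 k₁ k₂) R₀, DifferentiableAt ℂ U Z ∧ ‖fderiv ℂ U Z‖ ≤ δ)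
    (γ₀ : ℝ) (hγ₀ : 0 ≤ γ₀)
    (φ₁ φ₂ : Eu k₁ → Eu k₂) (D : Set (Eu k₁))
    (hφ₁lip : ∀ X₁ ∈ D, ∀ X₂ ∈ D, ‖φ₁ X₁ - φ₁ X₂‖ ≤ γ₀ * ‖X₁ - X₂‖)
    (hφ₂lip : ∀ X₁ ∈ D, ∀ X₂ ∈ D, ‖φ₂ X₁ - φ₂ X₂‖ ≤ γ₀ * ‖X₁ - X₂‖)
    (hφ₁graph : hgraph φ₁ D ⊆ ball (0 : Prod2 k₁ k₂) R₀)
    (hφ₂graph : hgraph φ₂ D ⊆ ball (0 : Prod2 k₁ k₂) R₀)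
    (ψ₁ ψ₂ : Eu k₁ → Eu k₂) (D₁ D₂ : Set (Eu k₁))
    (hψ₂lip : ∀ X₁ ∈ D₂, ∀ X₂ ∈ D₂, ‖ψ₂ X₁ - ψ₂ X₂‖ ≤ γ₀ * ‖X₁ - X₂‖)
    (hψ₁graph : g '' hgraph φ₁ D ⊆ hgraph ψ₁ D₁)
    (hψ₂graph : g '' hgraph φ₂ D ⊆ hgraph ψ₂ D₂) :
    ∀ X ∈ D,
      A X + R (mk2 X (φ₁ X)) ∈ D₁ ∩ D₂ →
      A X + R (mk2 X (φ₂ X)) ∈ D₁ ∩ D₂ →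
      ‖ψ₁ (A X + R (mk2 X (φ₁ X))) - ψ₂ (A X + R (mk2 X (φ₁ X)))‖ ≤
        (‖B‖ + δ * (1 + γ₀)) * ‖φ₁ X - φ₂ X‖ := by
  intro X hX h₁ h₂
  have hR := norm_sub_le_of_fderiv_le_on_ball hRdiff
    (hφ₁graph ⟨X, hX, rfl⟩) (hφ₂graph ⟨X, hX, rfl⟩)
  have hU := norm_sub_le_of_fderiv_le_on_ball hUdiff
    (hφ₁graph ⟨X, hX, rfl⟩) (hφ₂graph ⟨X, hX, rfl⟩)
  have hψ₁ : ψ₁ (A X + R (mk2 X (φ₁ X))) = B (φ₁ X) + U (mk2 X (φ₁ X)) :=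
    apply_eq_of_image_hgraph_subset hψ₁graph hX (hg _)
  have hψ₂ : ψ₂ (A X + R (mk2 X (φ₂ X))) = B (φ₂ X) + U (mk2 X (φ₂ X)) :=
    apply_eq_of_image_hgraph_subset hψ₂graph hX (hg _)
  have hlip := hψ₂lip _ h₂.2 _ h₁.2
  rw [add_sub_add_left_eq_sub, norm_sub_rev (R _), hψ₂] at hlip
  have hB : ‖B (φ₁ X) - B (φ₂ X)‖ ≤ ‖B‖ * ‖φ₁ X - φ₂ X‖ := by
    rw [← map_sub]
    exact B.le_opNorm _
  rw [hψ₁]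
  calc
    _ = ‖(B (φ₁ X) - B (φ₂ X)) + (U (mk2 X (φ₁ X)) - U (mk2 X (φ₂ X))) +
          (B (φ₂ X) + U (mk2 X (φ₂ X)) - ψ₂ (A X + R (mk2 X (φ₁ X))))‖ := by
      congr 1
      abel
    _ ≤ ‖B‖ * ‖φ₁ X - φ₂ X‖ + δ * ‖φ₁ X - φ₂ X‖ + γ₀ * (δ * ‖φ₁ X - φ₂ X‖) :=
      norm_add₃_le.trans <| add_le_add (add_le_add hB hU) <|
        hlip.trans (mul_le_mul_of_nonneg_left hR hγ₀)
    _ = (‖B‖ + δ * (1 + γ₀)) * ‖φ₁ X - φ₂ X‖ := by ring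
end
end

section
/- Graph transform by a near-identity linear map: Let γ > 0, 0 < γ₀ ≤ 1 and 0 ≤ ε < 1/3. Let T(X,Y) = (A X + C Y, B Y + D X) be a linear map of ℂ^{k₁} × ℂ^{k₂} with A invertible, ‖A⁻¹‖⁻¹ ≥ 1 − ε, ‖B‖ ≤ 1 + ε, ‖C‖ ≤ ε and ‖D‖ ≤ ε. Assume 2ε/(1−ε) < 1 and ((1+ε)e^{−γ}γ₀ + 2ε)/(1 − 3ε) ≤ γ₀. Let ρ > 0, 0 ≤ β ≤ ρ, and let φ : B_{k₁}(0,ρ) → ℂ^{k₂} satisfy Lip(φ) ≤ γ₀e^{−γ} and ‖φ(0)‖ ≤ β. Then T(horizontal graph of φ) is the horizontal graph of a function ψ defined over a subset of ℂ^{k₁} containing B_{k₁}(0, (1−4ε)ρ), with Lip(ψ) ≤ γ₀ and ‖ψ(0)‖ ≤ (1+γ₀)(1+2ε)β. -/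
open Metric Set

noncomputable section

/-- The image of a graph over `D` under `(X, Y) ↦ (L X, M X)` is a graph over `L '' D`
when `L` expands by at least `a > 0` and `M` is `K`-Lipschitz with `K ≤ γ₀ a`. -/
theorem exists_graph_reparametrization {E F : Type*} [NormedAddCommGroup E]
    [NormedAddCommGroup F] {D : Set E} {L : E → E} {M : E → F} {a K γ₀ : ℝ}
    (ha : 0 < a) (hγ₀ : 0 ≤ γ₀) (hK : K ≤ γ₀ * a)
    (hL : ∀ x ∈ D, ∀ y ∈ D, a * ‖x - y‖ ≤ ‖L x - L y‖)
    (hM : ∀ x ∈ D, ∀ y ∈ D, ‖M x - M y‖ ≤ K * ‖x - y‖) :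
    ∃ ψ : E → F, (∀ x ∈ D, ψ (L x) = M x) ∧
      ∀ z ∈ L '' D, ∀ w ∈ L '' D, ‖ψ z - ψ w‖ ≤ γ₀ * ‖z - w‖ := by
  have hinj : InjOn L D := by
    intro x hx y hy hxy
    have h := hL x hx y hy
    rw [hxy, sub_self, norm_zero] at h
    have h0 : ‖x - y‖ ≤ 0 := by
      by_contra! hpos
      exact absurd h (not_le.mpr (mul_pos ha hpos))
    exact sub_eq_zero.mp (norm_le_zero_iff.mp h0)
  have hψ : ∀ x ∈ D, M (Function.invFunOn L D (L x)) = M x := fun x hx => by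
    rw [hinj.leftInvOn_invFunOn hx]
  refine ⟨fun z => M (Function.invFunOn L D z), hψ, ?_⟩
  rintro _ ⟨x, hx, rfl⟩ _ ⟨y, hy, rfl⟩
  simp only [hψ x hx, hψ y hy]
  calc ‖M x - M y‖ ≤ K * ‖x - y‖ := hM x hx y hy
    _ ≤ γ₀ * a * ‖x - y‖ := by gcongr
    _ = γ₀ * (a * ‖x - y‖) := by ring
    _ ≤ γ₀ * ‖L x - L y‖ := by gcongr; exact hL x hx y hy

/-- Graph transform by a near-identity linear map. -/
theorem graph_transform_near_identity_linear
    (k₁ k₂ : ℕ) (hk₁ : 0 < k₁) (hk₂ : 0 < k₂)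
    (γ γ₀ ε : ℝ) (hγ : 0 < γ) (hγ₀ : 0 < γ₀) (hγ₀1 : γ₀ ≤ 1)
    (hε0 : 0 ≤ ε) (hε13 : ε < 1 / 3)
    (A : Eu k₁ ≃L[ℂ] Eu k₁) (B : Eu k₂ →L[ℂ] Eu k₂)
    (Cm : Eu k₂ →L[ℂ] Eu k₁) (Dm : Eu k₁ →L[ℂ] Eu k₂)
    (T : Prod2 k₁ k₂ → Prod2 k₁ k₂)
    (hT : ∀ (X : Eu k₁) (Y : Eu k₂), T (mk2 X Y) = mk2 (A X + Cm Y) (B Y + Dm X))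
    (hA : 1 - ε ≤ ‖(A.symm : Eu k₁ →L[ℂ] Eu k₁)‖⁻¹)
    (hB : ‖B‖ ≤ 1 + ε) (hC : ‖Cm‖ ≤ ε) (hD : ‖Dm‖ ≤ ε)
    (hε1 : 2 * ε / (1 - ε) < 1)
    (hε2 : ((1 + ε) * Real.exp (-γ) * γ₀ + 2 * ε) / (1 - 3 * ε) ≤ γ₀)
    (ρ β : ℝ) (hρ : 0 < ρ) (hβ0 : 0 ≤ β) (hβρ : β ≤ ρ)
    (φ : Eu k₁ → Eu k₂)
    (hφlip : ∀ X₁ ∈ ball (0 : Eu k₁) ρ, ∀ X₂ ∈ ball (0 : Eu k₁) ρ,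
      ‖φ X₁ - φ X₂‖ ≤ γ₀ * Real.exp (-γ) * ‖X₁ - X₂‖)
    (hφ0 : ‖φ 0‖ ≤ β) :
    ∃ (ψ : Eu k₁ → Eu k₂) (Dom : Set (Eu k₁)),
      ball (0 : Eu k₁) ((1 - 4 * ε) * ρ) ⊆ Dom ∧
      T '' hgraph φ (ball (0 : Eu k₁) ρ) = hgraph ψ Dom ∧
      (∀ X₁ ∈ Dom, ∀ X₂ ∈ Dom, ‖ψ X₁ - ψ X₂‖ ≤ γ₀ * ‖X₁ - X₂‖) ∧
      ‖ψ 0‖ ≤ (1 + γ₀) * (1 + 2 * ε) * β := by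
  have hexp : Real.exp (-γ) ≤ 1 := Real.exp_le_one_iff.mpr (by linarith)
  have hexp0 : 0 < Real.exp (-γ) := Real.exp_pos _
  set κ : ℝ := γ₀ * Real.exp (-γ) with hκ
  have hκ0 : 0 < κ := mul_pos hγ₀ hexp0
  have hκ1 : κ ≤ 1 := mul_le_one₀ hγ₀1 hexp0.le hexp
  have hmain : (1 + ε) * κ + 2 * ε ≤ γ₀ * (1 - 3 * ε) := by
    rw [div_le_iff₀ (by linarith)] at hε2
    linarith [hε2]
  have hε15 : 5 * ε ≤ 1 := by
    nlinarith [mul_nonneg hε0 hκ0.le]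
  have hlow : ∀ X, (1 - ε) * ‖X‖ ≤ ‖A X‖ := by
    intro X
    have h := (A.symm : Eu k₁ →L[ℂ] Eu k₁).le_opNorm (A X)
    simp only [ContinuousLinearEquiv.coe_coe, ContinuousLinearEquiv.symm_apply_apply] at h
    have hpos : 0 < ‖(A.symm : Eu k₁ →L[ℂ] Eu k₁)‖ := inv_pos.mp (by linarith)
    calc (1 - ε) * ‖X‖ ≤ ‖(A.symm : Eu k₁ →L[ℂ] Eu k₁)‖⁻¹ * ‖X‖ := by gcongr
      _ ≤ ‖A X‖ := by rwa [inv_mul_le_iff₀ hpos]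
  have hCn : ∀ Y, ‖Cm Y‖ ≤ ε * ‖Y‖ := fun Y => Cm.le_of_opNorm_le hC Y
  have hBn : ∀ Y, ‖B Y‖ ≤ (1 + ε) * ‖Y‖ := fun Y => B.le_of_opNorm_le hB Y
  have hDn : ∀ X, ‖Dm X‖ ≤ ε * ‖X‖ := fun X => Dm.le_of_opNorm_le hD X
  have h0mem : (0 : Eu k₁) ∈ ball (0 : Eu k₁) ρ := mem_ball_self hρ
  have hCφ : ∀ X₁ ∈ ball (0 : Eu k₁) ρ, ∀ X₂ ∈ ball (0 : Eu k₁) ρ,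
      ‖Cm (φ X₁) - Cm (φ X₂)‖ ≤ ε * ‖X₁ - X₂‖ := by
    intro X₁ h₁ X₂ h₂
    rw [← map_sub]
    refine (hCn _).trans (mul_le_mul_of_nonneg_left ?_ hε0)
    exact (hφlip X₁ h₁ X₂ h₂).trans (mul_le_of_le_one_left (norm_nonneg _) hκ1)
  set L : Eu k₁ → Eu k₁ := fun X => A X + Cm (φ X) with hLdef
  set M : Eu k₁ → Eu k₂ := fun X => B (φ X) + Dm X with hMdef
  have hL : ∀ X₁ ∈ ball (0 : Eu k₁) ρ, ∀ X₂ ∈ ball (0 : Eu k₁) ρ,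
      (1 - 2 * ε) * ‖X₁ - X₂‖ ≤ ‖L X₁ - L X₂‖ := by
    intro X₁ h₁ X₂ h₂
    have e : L X₁ - L X₂ = A (X₁ - X₂) + (Cm (φ X₁) - Cm (φ X₂)) := by
      simp only [hLdef, map_sub]; abel
    rw [e]
    have h := norm_sub_le_norm_add (A (X₁ - X₂)) (Cm (φ X₁) - Cm (φ X₂))
    linarith [hlow (X₁ - X₂), hCφ X₁ h₁ X₂ h₂]
  have hM : ∀ X₁ ∈ ball (0 : Eu k₁) ρ, ∀ X₂ ∈ ball (0 : Eu k₁) ρ,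
      ‖M X₁ - M X₂‖ ≤ ((1 + ε) * κ + ε) * ‖X₁ - X₂‖ := by
    intro X₁ h₁ X₂ h₂
    have e : M X₁ - M X₂ = B (φ X₁ - φ X₂) + Dm (X₁ - X₂) := by
      simp only [hMdef, map_sub]; abel
    rw [e]
    have h := mul_le_mul_of_nonneg_left (hφlip X₁ h₁ X₂ h₂) (by linarith : 0 ≤ 1 + ε)
    linarith [norm_add_le (B (φ X₁ - φ X₂)) (Dm (X₁ - X₂)), hBn (φ X₁ - φ X₂), hDn (X₁ - X₂)]
  have hLβ : ‖L 0‖ ≤ ε * β := by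
    simp only [hLdef, map_zero, zero_add]
    exact (hCn _).trans (by gcongr)
  have hsurj : ball (0 : Eu k₁) ((1 - 4 * ε) * ρ) ⊆ L '' ball (0 : Eu k₁) ρ := by
    intro Z hZ
    rw [mem_ball_zero_iff] at hZ
    have h12 : 0 < 1 - 2 * ε := by linarith
    set r := (‖Z‖ + ε * β) / (1 - 2 * ε) with hr
    have hr0 : 0 ≤ r := by positivity
    have hrρ : r < ρ := by
      rw [hr, div_lt_iff₀ h12]
      nlinarith [mul_le_mul_of_nonneg_left hβρ hε0, mul_nonneg hε0 hρ.le]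
    have happ : ApproximatesLinearOn L (A : Eu k₁ →L[ℂ] Eu k₁) (ball (0 : Eu k₁) ρ)
        ⟨ε, hε0⟩ := by
      intro X₁ h₁ X₂ h₂
      have e : L X₁ - L X₂ - A (X₁ - X₂) = Cm (φ X₁) - Cm (φ X₂) := by
        simp only [hLdef, map_sub]; abel
      exact (congrArg norm e).trans_le (hCφ X₁ h₁ X₂ h₂)
    have hmem := happ.surjOn_closedBall_of_nonlinearRightInverse A.toNonlinearRightInverse hr0
      (closedBall_subset_ball hrρ)
    have hZr : ‖Z‖ + ε * β = (1 - 2 * ε) * r := (mul_div_cancel₀ _ h12.ne').symm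
    obtain ⟨X, hX, hXZ⟩ := hmem (show Z ∈ _ by
      rw [mem_closedBall, dist_eq_norm]
      refine (norm_sub_le _ _).trans ((add_le_add_right hLβ _).trans ?_)
      rw [hZr]
      refine mul_le_mul_of_nonneg_right ?_ hr0
      change _ ≤ ‖(A.symm : Eu k₁ →L[ℂ] Eu k₁)‖⁻¹ - ε
      linarith)
    exact ⟨X, closedBall_subset_ball hrρ hX, hXZ⟩
  have hK : (1 + ε) * κ + ε ≤ γ₀ * (1 - 2 * ε) := by
    nlinarith [mul_nonneg hγ₀.le hε0]
  obtain ⟨ψ, hψ, hψlip⟩ :=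
    exists_graph_reparametrization (by linarith) hγ₀.le hK hL hM
  refine ⟨ψ, L '' ball 0 ρ, hsurj, ?_, hψlip, ?_⟩
  · simp only [hgraph, image_image]
    refine image_congr fun X hX => ?_
    rw [hT, hψ X hX]
  · obtain ⟨X, hX, hX0⟩ := hsurj (mem_ball_self (mul_pos (by linarith) hρ))
    rw [← hX0, hψ X hX]
    have hL0 := hL X hX 0 h0mem
    have hM0 := hM X hX 0 h0mem
    rw [hX0, sub_zero, zero_sub, norm_neg] at hL0
    rw [sub_zero] at hM0
    have hBβ : ‖M 0‖ ≤ (1 + ε) * β := by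
      simp only [hMdef, map_zero, add_zero]
      exact (hBn _).trans (by gcongr)
    calc ‖M X‖ ≤ ‖M 0‖ + ‖M X - M 0‖ := norm_le_norm_add_norm_sub' _ _
      _ ≤ (1 + ε) * β + γ₀ * (1 - 2 * ε) * ‖X‖ := by
        gcongr
        exact hM0.trans (by gcongr)
      _ ≤ (1 + ε) * β + γ₀ * (ε * β) := by
        rw [mul_assoc γ₀]
        gcongr _ + γ₀ * ?_
        exact hL0.trans hLβ
      _ ≤ (1 + γ₀) * (1 + 2 * ε) * β := by
        nlinarith [mul_nonneg hε0 hβ0, mul_nonneg hγ₀.le hβ0,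
          mul_nonneg hγ₀.le (mul_nonneg hε0 hβ0)]
end
end

section
/- Lipschitz dependence of the intersection point of transverse Lipschitz graphs: Fix integers k₁, k₂ ≥ 1, R₁, R₂ > 0 and 0 ≤ γ₀ < 1. For i = 1, 2 let ψⁱ : B̄_{k₁}(0,R₁) → B̄_{k₂}(0,R₂) and φⁱ : B̄_{k₂}(0,R₂) → B̄_{k₁}(0,R₁) be γ₀-Lipschitz maps, and let pᵢ = (φⁱ(Yᵢ), Yᵢ) be the unique intersection point of the horizontal graph of ψⁱ and the vertical graph of φⁱ (so Yᵢ = ψⁱ(φⁱ(Yᵢ))). Set D_ψ = sup_{‖X‖ ≤ R₁} ‖ψ¹(X) − ψ²(X)‖ and D_φ = sup_{‖Y‖ ≤ R₂} ‖φ¹(Y) − φ²(Y)‖. Then ‖Y₁ − Y₂‖ ≤ (D_ψ + γ₀ D_φ)/(1 − γ₀²) and ‖p₁ − p₂‖ ≤ (D_ψ + D_φ)/(1 − γ₀). -/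
open Metric Set

noncomputable section

/-- ℂ^{k₁} × ℂ^{k₂} with the Euclidean (L²) product norm. -/
abbrev Prod2' (k₁ k₂ : ℕ) : Type :=
  WithLp 2 (EuclideanSpace ℂ (Fin k₁) × EuclideanSpace ℂ (Fin k₂))

/-- The point (X,Y) of ℂ^{k₁} × ℂ^{k₂}. -/
def mk2' {k₁ k₂ : ℕ} (X : EuclideanSpace ℂ (Fin k₁)) (Y : EuclideanSpace ℂ (Fin k₂)) :
    Prod2' k₁ k₂ :=
  (WithLp.equiv 2 (EuclideanSpace ℂ (Fin k₁) × EuclideanSpace ℂ (Fin k₂))).symm (X, Y)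

/-- The Euclidean product distance is at most the sum of the component distances. -/
lemma norm_mk2'_sub_mk2'_le {k₁ k₂ : ℕ} (X X' : EuclideanSpace ℂ (Fin k₁))
    (Y Y' : EuclideanSpace ℂ (Fin k₂)) :
    ‖mk2' X Y - mk2' X' Y'‖ ≤ ‖X - X'‖ + ‖Y - Y'‖ := by
  have h : ‖mk2' X Y - mk2' X' Y'‖ = √(‖X - X'‖ ^ 2 + ‖Y - Y'‖ ^ 2) :=
    WithLp.prod_norm_eq_of_L2 _
  rw [h]
  refine Real.sqrt_le_iff.mpr ⟨by positivity, ?_⟩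
  nlinarith [norm_nonneg (X - X'), norm_nonneg (Y - Y'),
    mul_nonneg (norm_nonneg (X - X')) (norm_nonneg (Y - Y'))]

/-- Lipschitz dependence of the intersection point of transverse
Lipschitz graphs. -/
theorem lipschitz_dependence_of_intersection_point
    (k₁ k₂ : ℕ) (hk₁ : 0 < k₁) (hk₂ : 0 < k₂)
    (R₁ R₂ γ₀ : ℝ) (hR₁ : 0 < R₁) (hR₂ : 0 < R₂) (hγ₀ : 0 ≤ γ₀) (hγ₀1 : γ₀ < 1)
    (ψ₁ ψ₂ : EuclideanSpace ℂ (Fin k₁) → EuclideanSpace ℂ (Fin k₂))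
    (φ₁ φ₂ : EuclideanSpace ℂ (Fin k₂) → EuclideanSpace ℂ (Fin k₁))
    (hψ₁maps : MapsTo ψ₁ (closedBall (0 : EuclideanSpace ℂ (Fin k₁)) R₁)
      (closedBall (0 : EuclideanSpace ℂ (Fin k₂)) R₂))
    (hψ₂maps : MapsTo ψ₂ (closedBall (0 : EuclideanSpace ℂ (Fin k₁)) R₁)
      (closedBall (0 : EuclideanSpace ℂ (Fin k₂)) R₂))
    (hφ₁maps : MapsTo φ₁ (closedBall (0 : EuclideanSpace ℂ (Fin k₂)) R₂)
      (closedBall (0 : EuclideanSpace ℂ (Fin k₁)) R₁))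
    (hφ₂maps : MapsTo φ₂ (closedBall (0 : EuclideanSpace ℂ (Fin k₂)) R₂)
      (closedBall (0 : EuclideanSpace ℂ (Fin k₁)) R₁))
    (hψ₁lip : ∀ X₁ ∈ closedBall (0 : EuclideanSpace ℂ (Fin k₁)) R₁,
      ∀ X₂ ∈ closedBall (0 : EuclideanSpace ℂ (Fin k₁)) R₁,
        ‖ψ₁ X₁ - ψ₁ X₂‖ ≤ γ₀ * ‖X₁ - X₂‖)
    (hψ₂lip : ∀ X₁ ∈ closedBall (0 : EuclideanSpace ℂ (Fin k₁)) R₁,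
      ∀ X₂ ∈ closedBall (0 : EuclideanSpace ℂ (Fin k₁)) R₁,
        ‖ψ₂ X₁ - ψ₂ X₂‖ ≤ γ₀ * ‖X₁ - X₂‖)
    (hφ₁lip : ∀ Y₁ ∈ closedBall (0 : EuclideanSpace ℂ (Fin k₂)) R₂,
      ∀ Y₂ ∈ closedBall (0 : EuclideanSpace ℂ (Fin k₂)) R₂,
        ‖φ₁ Y₁ - φ₁ Y₂‖ ≤ γ₀ * ‖Y₁ - Y₂‖)
    (hφ₂lip : ∀ Y₁ ∈ closedBall (0 : EuclideanSpace ℂ (Fin k₂)) R₂,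
      ∀ Y₂ ∈ closedBall (0 : EuclideanSpace ℂ (Fin k₂)) R₂,
        ‖φ₂ Y₁ - φ₂ Y₂‖ ≤ γ₀ * ‖Y₁ - Y₂‖)
    (Y₁ Y₂ : EuclideanSpace ℂ (Fin k₂))
    (hY₁mem : Y₁ ∈ closedBall (0 : EuclideanSpace ℂ (Fin k₂)) R₂)
    (hY₂mem : Y₂ ∈ closedBall (0 : EuclideanSpace ℂ (Fin k₂)) R₂)
    (hY₁fix : Y₁ = ψ₁ (φ₁ Y₁)) (hY₂fix : Y₂ = ψ₂ (φ₂ Y₂))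
    (Dψ Dφ : ℝ)
    (hDψ : ∀ X ∈ closedBall (0 : EuclideanSpace ℂ (Fin k₁)) R₁, ‖ψ₁ X - ψ₂ X‖ ≤ Dψ)
    (hDφ : ∀ Y ∈ closedBall (0 : EuclideanSpace ℂ (Fin k₂)) R₂, ‖φ₁ Y - φ₂ Y‖ ≤ Dφ) :
    ‖Y₁ - Y₂‖ ≤ (Dψ + γ₀ * Dφ) / (1 - γ₀ ^ 2) ∧
    ‖mk2' (φ₁ Y₁) Y₁ - mk2' (φ₂ Y₂) Y₂‖ ≤ (Dψ + Dφ) / (1 - γ₀) := by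
  have hX : ‖φ₁ Y₁ - φ₂ Y₂‖ ≤ Dφ + γ₀ * ‖Y₁ - Y₂‖ := by
    have h := norm_sub_le_norm_sub_add_norm_sub (φ₁ Y₁) (φ₂ Y₁) (φ₂ Y₂)
    linarith [hDφ Y₁ hY₁mem, hφ₂lip Y₁ hY₁mem Y₂ hY₂mem]
  have hY : ‖Y₁ - Y₂‖ ≤ Dψ + γ₀ * ‖φ₁ Y₁ - φ₂ Y₂‖ := by
    have h := norm_sub_le_norm_sub_add_norm_sub (ψ₁ (φ₁ Y₁)) (ψ₂ (φ₁ Y₁)) (ψ₂ (φ₂ Y₂))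
    rw [← hY₁fix, ← hY₂fix] at h
    have hψ := hDψ _ (hφ₁maps hY₁mem)
    have hlip := hψ₂lip _ (hφ₁maps hY₁mem) _ (hφ₂maps hY₂mem)
    rw [← hY₁fix] at hψ
    rw [← hY₂fix] at hlip
    linarith
  constructor
  · rw [le_div_iff₀ (by nlinarith)]
    nlinarith [mul_le_mul_of_nonneg_left hX hγ₀]
  · refine (norm_mk2'_sub_mk2'_le _ _ _ _).trans ?_
    rw [le_div_iff₀ (by linarith)]
    linarith
end
end

section
/- Recurrence in multiplicative time windows for ergodic systems: Let (X, μ) be a probability space and f : X → X a measure-preserving transformation that is ergodic with respect to μ. Let C ⊆ X be a measurable set with μ(C) > 0 and let r > 0. Then for μ-almost every x ∈ C there exists M ∈ ℕ such that for every integer m ≥ M there is an integer q with m ≤ q ≤ m(1+r) and f^q(x) ∈ C. -/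
open MeasureTheory Filter

/-- The points of `C` which do not return to `C` at any of the times `1, …, j`. -/
def noReturnBefore {X : Type*} (f : X → X) (C : Set X) (j : ℕ) : Set X :=
  {x | x ∈ C ∧ ∀ i, 1 ≤ i → i ≤ j → f^[i] x ∉ C}

theorem measurableSet_noReturnBefore {X : Type*} [MeasurableSpace X] {f : X → X}
    (hf : Measurable f) {C : Set X} (hC : MeasurableSet C) (j : ℕ) :
    MeasurableSet (noReturnBefore f C j) := by
  have h : noReturnBefore f C j = C ∩ ⋂ i, ⋂ (_ : 1 ≤ i), ⋂ (_ : i ≤ j), (f^[i] ⁻¹' C)ᶜ := by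
    ext x
    simp [noReturnBefore]
  rw [h]
  exact hC.inter <| .iInter fun i => .iInter fun _ => .iInter fun _ =>
    (hf.iterate i hC).compl

/-- A form of Kac's inequality: the tails of the return time to `C` have total mass at most the
mass of the whole space. -/
theorem tsum_measure_noReturnBefore_le {X : Type*} [MeasurableSpace X] {μ : Measure X}
    {f : X → X} (hf : MeasurePreserving f μ μ) {C : Set X} (hC : MeasurableSet C) :
    ∑' j, μ (noReturnBefore f C j) ≤ μ Set.univ := by
  refine ENNReal.tsum_le_of_sum_range_le fun n => ?_
  have hmeas := measurableSet_noReturnBefore hf.measurable hC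
  -- Pull the `j`-th set back to the event that the last visit to `C` up to time `n` is at `n - j`.
  calc ∑ j ∈ Finset.range n, μ (noReturnBefore f C j)
      = ∑ j ∈ Finset.range n, μ (f^[n - j] ⁻¹' noReturnBefore f C j) :=
        Finset.sum_congr rfl fun j _ =>
          ((hf.iterate _).measure_preimage (hmeas j).nullMeasurableSet).symm
    _ ≤ μ Set.univ := by
        refine sum_measure_le_measure_univ
          (fun j _ => (hf.measurable.iterate _ (hmeas j)).nullMeasurableSet) ?_
        have hlt : ∀ i < n, ∀ j < n, i < j →
            Disjoint (f^[n - i] ⁻¹' noReturnBefore f C i)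
              (f^[n - j] ⁻¹' noReturnBefore f C j) := by
          intro i hi j hj hij
          refine Set.disjoint_left.2 fun x hx hx' => hx'.2 (j - i) (by lia) (by lia) ?_
          rw [← Function.iterate_add_apply, show j - i + (n - j) = n - i by lia]
          exact hx.1
        intro i hi j hj hij
        have hi := Finset.mem_range.1 hi
        have hj := Finset.mem_range.1 hj
        rcases lt_or_gt_of_ne hij with h | h
        · exact (hlt i hi j hj h).aedisjoint
        · exact (hlt j hj i hi h).symm.aedisjoint

/-- Almost every point returns to `C`, after a late visit at time `n`, within time `n / K`. -/
theorem ae_eventually_iterate_notMem_noReturnBefore {X : Type*} [MeasurableSpace X]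
    {μ : Measure X} [IsFiniteMeasure μ] {f : X → X} (hf : MeasurePreserving f μ μ) {C : Set X}
    (hC : MeasurableSet C) (K : ℕ) [NeZero K] :
    ∀ᵐ x ∂μ, ∀ᶠ n in atTop, f^[n] x ∉ noReturnBefore f C (n / K) := by
  refine ae_eventually_notMem (s := fun n => f^[n] ⁻¹' noReturnBefore f C (n / K)) ?_
  have hmeas := measurableSet_noReturnBefore hf.measurable hC
  have hsum : ∑' n, μ (f^[n] ⁻¹' noReturnBefore f C (n / K))
      = ∑' j, K * μ (noReturnBefore f C j) := by
    calc ∑' n, μ (f^[n] ⁻¹' noReturnBefore f C (n / K))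
        = ∑' n, μ (noReturnBefore f C (Nat.divModEquiv K n).1) :=
          tsum_congr fun n => (hf.iterate n).measure_preimage (hmeas _).nullMeasurableSet
      _ = ∑' p : ℕ × Fin K, μ (noReturnBefore f C p.1) :=
          (Nat.divModEquiv K).tsum_eq fun p : ℕ × Fin K => μ (noReturnBefore f C p.1)
      _ = ∑' j, K * μ (noReturnBefore f C j) := by
          rw [ENNReal.tsum_prod']
          simp
  rw [hsum, ENNReal.tsum_mul_left]
  exact ENNReal.mul_ne_top (ENNReal.natCast_ne_top K)
    ((tsum_measure_noReturnBefore_le hf hC).trans_lt (measure_lt_top μ _)).ne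

/-- Recurrence in multiplicative time windows for ergodic systems. -/
theorem recurrence_in_multiplicative_time_windows
    {X : Type*} [MeasurableSpace X] (μ : Measure X) [IsProbabilityMeasure μ]
    (f : X → X) (hf : MeasurePreserving f μ μ) (herg : Ergodic f μ)
    (C : Set X) (hC : MeasurableSet C) (hCpos : 0 < μ C)
    (r : ℝ) (hr : 0 < r) :
    ∀ᵐ x ∂μ, x ∈ C →
      ∃ M : ℕ, ∀ m : ℕ, M ≤ m →
        ∃ q : ℕ, m ≤ q ∧ (q : ℝ) ≤ (m : ℝ) * (1 + r) ∧ f^[q] x ∈ C := by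
  classical
  obtain ⟨k, hk⟩ := exists_nat_one_div_lt hr
  filter_upwards [ae_eventually_iterate_notMem_noReturnBefore hf hC (k + 1),
    hf.conservative.ae_mem_imp_frequently_image_mem hC.nullMeasurableSet] with x hret hfreq hx
  obtain ⟨N, hN⟩ := eventually_atTop.1 hret
  obtain ⟨M, hNM, hM⟩ := frequently_atTop.1 (hfreq hx) N
  refine ⟨M, fun m hm => ?_⟩
  -- `n` is the last visit to `C` up to time `m`.
  set n := Nat.findGreatest (fun i => f^[i] x ∈ C) m
  have hnC : f^[n] x ∈ C := Nat.findGreatest_spec (P := fun i => f^[i] x ∈ C) hm hM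
  have hMn : M ≤ n := Nat.le_findGreatest hm hM
  have hnm : n ≤ m := Nat.findGreatest_le m
  obtain ⟨i, hi, hi', hiC⟩ : ∃ i, 1 ≤ i ∧ i ≤ n / (k + 1) ∧ f^[i] (f^[n] x) ∈ C := by
    by_contra! h
    exact hN n (hNM.trans hMn) ⟨hnC, h⟩
  rw [← Function.iterate_add_apply] at hiC
  refine ⟨i + n, ?_, ?_, hiC⟩
  · by_contra! h
    exact Nat.findGreatest_is_greatest (P := fun i => f^[i] x ∈ C)
      (show n < i + n by lia) h.le hiC
  · have hir : (i : ℝ) ≤ m * r := calc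
      (i : ℝ) ≤ (n / (k + 1) : ℕ) := by exact_mod_cast hi'
      _ ≤ n / ((k + 1 : ℕ) : ℝ) := Nat.cast_div_le
      _ = n * (1 / ((k : ℝ) + 1)) := by push_cast; ring
      _ ≤ m * r := by gcongr
    have hnm' : (n : ℝ) ≤ m := by exact_mod_cast hnm
    push_cast
    linarith
end
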